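/- arXiv:2504.14711 — 2 statements merged into one kernel-verified Lean document; each statement's English description precedes it below -/
import Mathlib

section
/- Let T be a forest on n vertices and let k ≥ 3 be an integer. Then T has an equitable k-coloring if and only if for every vertex v of T there is an independent set of T containing v of size at least ⌊n/k⌋ (i.e., α_v(T) ≥ ⌊n/k⌋ for every vertex v). -/
section

open Finset

namespace SimpleGraph

variable {V : Type*} {T : SimpleGraph V}

theorem IsAcyclic.card_edgeFinset_le [Fintype V] [DecidableRel T.Adj] (h : T.IsAcyclic) :
    #T.edgeFinset ≤ Fintype.card V := by
  classical
  cases isEmpty_or_nonempty V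
  · have : #T.edgeFinset = 0 := by
      rw [card_eq_zero, Finset.eq_empty_iff_forall_notMem]
      rintro ⟨u, v⟩
      exact isEmptyElim u
    omega
  · obtain ⟨F, hF, hmax⟩ :=
      (Set.toFinite {G : SimpleGraph V | G.IsAcyclic}).exists_le_maximal h
    have htree : F.IsTree := maximal_isAcyclic_iff_isTree.mp hmax
    have := htree.card_edgeFinset
    have := Finset.card_le_card (edgeFinset_mono hF)
    omega

/-- A forest has at most as many edges as it has non-isolated vertices. -/
theorem IsAcyclic.card_edgeFinset_add_card_isolated_le [Fintype V] [DecidableRel T.Adj]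
    (h : T.IsAcyclic) : #T.edgeFinset + #{v | T.degree v = 0} ≤ Fintype.card V := by
  classical
  have h1 := (h.induce {v | T.degree v ≠ 0}).card_edgeFinset_le
  have h2 := card_edgeFinset_induce_of_support_subset (G := T) (s := {v | T.degree v ≠ 0})
    (fun v hv => by
      rw [Set.mem_ofPred_eq, Ne, degree_eq_zero_iff_notMem_support]
      exact not_not.mpr hv)
  have h3 : Fintype.card {v | T.degree v ≠ 0} = #{v | T.degree v ≠ 0} := by
    exact Fintype.card_subtype _
  have h4 := Finset.card_filter_add_card_filter_not (s := univ) (fun v => T.degree v = 0)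
  have h5 : #T.edgeFinset ≤ #{v | T.degree v ≠ 0} := by
    rw [← h2, ← h3]
    convert h1
  rw [card_univ] at h4
  simp only [Ne] at h5
  omega

theorem IsAcyclic.card_inter_neighborFinset_le_one [Fintype V] [DecidableEq V]
    [DecidableRel T.Adj] (h : T.IsAcyclic) {u v : V} (huv : u ≠ v) :
    #(T.neighborFinset u ∩ T.neighborFinset v) ≤ 1 := by
  rw [Finset.card_le_one]
  intro a ha b hb
  simp only [mem_inter, mem_neighborFinset] at ha hb
  have key : ∀ c (h₁ : T.Adj u c) (h₂ : T.Adj v c),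
      (Walk.cons h₁ (Walk.cons h₂.symm Walk.nil)).IsPath := by
    intro c h₁ h₂
    simp [h₁.ne, h₂.ne', huv]
  have := (h.subsingleton_path u v).elim ⟨_, key a ha.1 ha.2⟩ ⟨_, key b hb.1 hb.2⟩
  simpa using congrArg (fun p => p.1.snd) this

theorem IsBipartiteWith.mem_iff_notMem_of_adj [Fintype V] [DecidableEq V] {Y : Finset V}
    (hY : T.IsBipartiteWith Y (Yᶜ : Finset V)) {u v : V} (huv : T.Adj u v) :
    u ∈ Y ↔ v ∉ Y := by
  have := hY.mem_of_adj huv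
  simp only [mem_coe, mem_compl] at this
  tauto

/-- A forest has a bipartition whose first part contains at most half of the vertices. -/
theorem IsAcyclic.exists_bipartition [Fintype V] [DecidableEq V] (h : T.IsAcyclic) :
    ∃ Y : Finset V, T.IsBipartiteWith Y (Yᶜ : Finset V) ∧ 2 * #Y ≤ Fintype.card V := by
  classical
  obtain ⟨s, t, hst⟩ := h.isBipartite.exists_isBipartiteWith
  have hY : T.IsBipartiteWith s.toFinset ((s.toFinset)ᶜ : Finset V) := by
    refine ⟨by simpa using disjoint_compl_right, fun v w hvw => ?_⟩
    have hd := Set.disjoint_left.mp hst.disjoint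
    have := hst.mem_of_adj hvw
    simp only [Set.coe_toFinset, coe_compl, Set.mem_compl_iff]
    grind
  have := Finset.card_add_card_compl s.toFinset
  rcases le_total (2 * #s.toFinset) (Fintype.card V) with hle | hle
  · exact ⟨_, hY, hle⟩
  · exact ⟨(s.toFinset)ᶜ, by simpa using hY.symm, by omega⟩

/-- `T` has a proper `k`-coloring whose color classes differ in size by at most one. -/
def EquitablyColorable [Fintype V] (T : SimpleGraph V) (k : ℕ) : Prop :=
  ∃ f : V → Fin k,
    (∀ ⦃u v : V⦄, T.Adj u v → f u ≠ f v) ∧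
    (∀ c c' : Fin k, #{v | f v = c} ≤ #{v | f v = c'} + 1)

theorem EquitablyColorable.of_card_le [Fintype V] (T : SimpleGraph V) {k : ℕ}
    (h : Fintype.card V ≤ k) : T.EquitablyColorable k := by
  obtain ⟨f⟩ : Nonempty (V ↪ Fin k) := Function.Embedding.nonempty_of_card_le (by simpa using h)
  refine ⟨f, fun u v huv => f.injective.ne huv.ne, fun c c' => ?_⟩
  have : #{v | f v = c} ≤ 1 := by
    rw [Finset.card_le_one]
    intro a ha b hb
    simp only [mem_filter, mem_univ, true_and] at ha hb
    exact f.injective (ha.trans hb.symm)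
  omega

theorem EquitablyColorable.of_partition_three [Fintype V] [DecidableEq V] {A B : Finset V} {q : ℕ}
    (hdisj : Disjoint A B)
    (hA : ∀ a ∈ A, ∀ b ∈ A, ¬ T.Adj a b) (hB : ∀ a ∈ B, ∀ b ∈ B, ¬ T.Adj a b)
    (hC : ∀ a ∉ A, a ∉ B → ∀ b ∉ A, b ∉ B → ¬ T.Adj a b)
    (hqA : q ≤ #A) (hAq : #A ≤ q + 1) (hqB : q ≤ #B) (hBq : #B ≤ q + 1)
    (hqC : q + #A + #B ≤ Fintype.card V) (hCq : Fintype.card V ≤ q + 1 + #A + #B) :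
    T.EquitablyColorable 3 := by
  have hAB := Finset.disjoint_left.mp hdisj
  obtain ⟨f, hf⟩ : ∃ f : V → Fin 3, ∀ v, f v = if v ∈ A then 0 else if v ∈ B then 1 else 2 :=
    ⟨_, fun _ => rfl⟩
  have h0 : ({v | f v = 0} : Finset V) = A := by
    ext v; simp only [mem_filter, mem_univ, true_and, hf]; split_ifs <;> simp_all
  have h1 : ({v | f v = 1} : Finset V) = B := by
    ext v; simp only [mem_filter, mem_univ, true_and, hf]; split_ifs <;> simp_all
  have h2 : ({v | f v = 2} : Finset V) = (A ∪ B)ᶜ := by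
    ext v; simp only [mem_filter, mem_univ, true_and, hf]; split_ifs <;> simp_all
  have hcard := card_union_of_disjoint hdisj
  have hcompl := card_add_card_compl (A ∪ B)
  have key : ∀ c : Fin 3, q ≤ #{v | f v = c} ∧ #{v | f v = c} ≤ q + 1 := by
    intro c
    fin_cases c
    · simp only [Fin.zero_eta, h0]; omega
    · simp only [Fin.mk_one, h1]; omega
    · simp only [Fin.reduceFinMk, h2]; omega
  refine ⟨f, fun u v huv => ?_, fun c c' => ?_⟩
  · have := hA u
    have := hB u
    have := hC u
    rw [hf, hf]
    split_ifs <;> simp <;> grind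
  · have := (key c).2
    have := (key c').1
    omega

theorem _root_.Finset.exists_subset_card_eq_forall_le {α : Type*} [DecidableEq α] (s : Finset α)
    (d : α → ℕ) {b : ℕ} (hb : b ≤ #s) :
    ∃ t ⊆ s, #t = b ∧ ∀ x ∈ t, ∀ y ∈ s \ t, d x ≤ d y := by
  induction b with
  | zero => exact ⟨∅, by simp, by simp, by simp⟩
  | succ b ih =>
    obtain ⟨t, hts, htb, ht⟩ := ih (by omega)
    have hne : (s \ t).Nonempty := by
      rw [← card_pos, card_sdiff_of_subset hts]
      omega
    obtain ⟨m, hm, hmin⟩ := exists_min_image (s \ t) d hne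
    rw [mem_sdiff] at hm
    refine ⟨insert m t, by grind, by simp [hm.2, htb], ?_⟩
    intro x hx y hy
    have := hmin y
    have := ht x
    grind

/-- A set of size `b` of smallest values of `d` has at most average sum. -/
theorem _root_.Finset.exists_subset_card_eq_sum_mul_le {α : Type*} [DecidableEq α] (s : Finset α)
    (d : α → ℕ) {b : ℕ} (hb : b ≤ #s) :
    ∃ t ⊆ s, #t = b ∧ #s * ∑ x ∈ t, d x ≤ b * ∑ x ∈ s, d x := by
  obtain ⟨t, hts, htb, ht⟩ := s.exists_subset_card_eq_forall_le d hb
  refine ⟨t, hts, htb, ?_⟩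
  have h : ∑ x ∈ t, ∑ _y ∈ s \ t, d x ≤ ∑ _x ∈ t, ∑ y ∈ s \ t, d y :=
    sum_le_sum fun x hx => sum_le_sum fun y hy => ht x hx y hy
  simp only [sum_const, smul_eq_mul, htb, ← mul_sum] at h
  have hs := sum_sdiff (f := d) hts
  have hc := card_sdiff_add_card_eq_card hts
  rw [← hs, ← hc, htb]
  nlinarith

/-- Disjoint subsets of prescribed sizes of two given sets. -/
theorem _root_.Finset.exists_disjoint_subsets_card_eq {α : Type*} [DecidableEq α] {s t : Finset α}
    {a b : ℕ} (hs : a ≤ #s) (ht : b ≤ #t) (hst : a + b ≤ #(s ∪ t)) :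
    ∃ s' ⊆ s, ∃ t' ⊆ t, Disjoint s' t' ∧ #s' = a ∧ #t' = b := by
  rcases le_total a #(s \ t) with h | h
  · obtain ⟨s', hs', ha⟩ := exists_subset_card_eq h
    obtain ⟨t', ht', hb⟩ := exists_subset_card_eq ht
    exact ⟨s', by grind, t', ht', by rw [Finset.disjoint_left]; grind, ha, hb⟩
  · obtain ⟨s', hs₁, hs₂, ha⟩ := exists_subsuperset_card_eq sdiff_subset h hs
    have hsub : s' ⊆ s ∪ t := hs₂.trans subset_union_left
    have : b ≤ #((s ∪ t) \ s') := by
      rw [card_sdiff_of_subset hsub]; omega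
    obtain ⟨t', ht', hb⟩ := exists_subset_card_eq this
    exact ⟨s', hs₂, t', by grind, by rw [Finset.disjoint_left]; grind, ha, hb⟩

/-- A third class can be cut out of the two parts of a bipartition. -/
theorem IsBipartiteWith.equitablyColorable_three_of_le_card [Fintype V] [DecidableEq V]
    [DecidableRel T.Adj]
    {Y : Finset V} (hY : T.IsBipartiteWith Y (Yᶜ : Finset V))
    (hedges : #T.edgeFinset ≤ Fintype.card V)
    (hhalf : 2 * #Y ≤ Fintype.card V) (hq : 3 ≤ Fintype.card V) (hYq : Fintype.card V / 3 ≤ #Y) :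
    T.EquitablyColorable 3 := by
  have hadj : ∀ ⦃u v⦄, T.Adj u v → (u ∈ Y ↔ v ∉ Y) := fun _ _ => hY.mem_iff_notMem_of_adj
  have hcompl := card_add_card_compl Y
  obtain ⟨q, hqdef⟩ : ∃ q, q = Fintype.card V / 3 := ⟨_, rfl⟩
  obtain ⟨s₁, s₂, hs₁, hs₁', hs₂, hs₂', hsum, hsum', hYs, hXs, hprod⟩ : ∃ s₁ s₂ : ℕ,
      q ≤ s₁ ∧ s₁ ≤ q + 1 ∧ q ≤ s₂ ∧ s₂ ≤ q + 1 ∧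
      q + s₁ + s₂ ≤ Fintype.card V ∧ Fintype.card V ≤ q + 1 + s₁ + s₂ ∧ s₂ ≤ #Y ∧ s₁ ≤ #Yᶜ ∧
      (#Y - s₂) * Fintype.card V < #Y * (s₁ + 1) := by
    rcases hYq.eq_or_lt with heq | hlt
    · refine ⟨q + (Fintype.card V % 3 + 1) / 2, q, by omega, by omega, by omega, by omega,
        by omega, by omega, by omega, by omega, ?_⟩
      have : #Y - q = 0 := by omega
      rw [this, zero_mul]
      apply Nat.mul_pos <;> omega
    · refine ⟨q + (Fintype.card V % 3 + 1) / 2, q + Fintype.card V % 3 / 2, by omega, by omega,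
        by omega, by omega, by omega, by omega, by omega, by omega, ?_⟩
      obtain ⟨b, hb⟩ : ∃ b, #Y = q + Fintype.card V % 3 / 2 + b :=
        ⟨#Y - (q + Fintype.card V % 3 / 2), by omega⟩
      rw [hb, Nat.add_sub_cancel_left]
      have h3 : Fintype.card V % 3 < 3 := Nat.mod_lt _ (by norm_num)
      have hn : Fintype.card V = 3 * q + Fintype.card V % 3 := by omega
      generalize Fintype.card V % 3 = r at *
      rw [hn] at hhalf ⊢
      interval_cases r <;> simp at hhalf hb ⊢ <;> nlinarith
  obtain ⟨B, hBY, hBb, hBsum⟩ := Y.exists_subset_card_eq_sum_mul_le (fun v => T.degree v)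
    (b := #Y - s₂) (by omega)
  rw [isBipartiteWith_sum_degrees_eq_card_edges hY] at hBsum
  have hN : ∑ x ∈ B, T.degree x ≤ s₁ := by
    by_contra! hlt
    have := Nat.mul_le_mul_left #Y hlt
    have := Nat.mul_le_mul_left (#Y - s₂) hedges
    simp only [Nat.succ_eq_add_one] at *
    omega
  obtain ⟨N, hNdef⟩ : ∃ N, N = B.biUnion fun x => T.neighborFinset x := ⟨_, rfl⟩
  have hNcard : #N ≤ s₁ := by
    rw [hNdef]
    exact card_biUnion_le.trans (by simpa using hN)
  have hNX : N ⊆ Yᶜ := by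
    intro v hv
    rw [hNdef] at hv
    simp only [mem_biUnion, mem_neighborFinset] at hv
    obtain ⟨u, hu, huv⟩ := hv
    rw [mem_compl]
    exact (hadj huv).mp (hBY hu)
  obtain ⟨A, hNA, hAX, hAcard⟩ := exists_subsuperset_card_eq hNX hNcard hXs
  have hAY : ∀ x ∈ A, x ∉ Y := fun x hx => mem_compl.mp (hAX hx)
  have hmem : ∀ a ∈ B, ∀ b, T.Adj a b → b ∈ A := by
    intro a ha b hab
    apply hNA
    rw [hNdef, mem_biUnion]
    exact ⟨a, ha, by simpa using hab⟩
  refine EquitablyColorable.of_partition_three (q := q) (A := A) (B := Y \ B) ?_ ?_ ?_ ?_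
    (by omega) (by omega) ?_ ?_ ?_ ?_
  · rw [Finset.disjoint_left]
    exact fun x hx hx' => hAY x hx (mem_sdiff.mp hx').1
  · exact fun a ha b hb hab => hAY a ha ((hadj hab).mpr (hAY b hb))
  · exact fun a ha b hb hab => (hadj hab).mp (mem_sdiff.mp ha).1 (mem_sdiff.mp hb).1
  · intro a ha ha' b hb hb' hab
    simp only [mem_sdiff, not_and, not_not] at ha' hb'
    by_cases haY : a ∈ Y
    · exact hb (hmem a (ha' haY) b hab)
    · exact ha (hmem b (hb' ((hadj hab.symm).mpr haY)) a hab.symm)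
  all_goals
    rw [card_sdiff_of_subset hBY, hBb]
    omega

/-- The vertices of `X` that have no neighbor in `Z`. -/
def freePart (T : SimpleGraph V) [DecidableRel T.Adj] (X Z : Finset V) : Finset V :=
  {x ∈ X | ∀ z ∈ Z, ¬ T.Adj x z}

theorem mem_freePart [DecidableRel T.Adj] {X Z : Finset V} {x : V} :
    x ∈ T.freePart X Z ↔ x ∈ X ∧ ∀ z ∈ Z, ¬ T.Adj x z :=
  mem_filter

theorem freePart_anti [DecidableRel T.Adj] {X Z W : Finset V} (h : Z ⊆ W) :
    T.freePart X W ⊆ T.freePart X Z := fun x hx => by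
  rw [mem_freePart] at hx ⊢
  exact ⟨hx.1, fun z hz => hx.2 z (h hz)⟩

theorem two_le_degree_of_adj [Fintype V] [DecidableEq V] [DecidableRel T.Adj] {x z w : V}
    (hz : T.Adj x z) (hw : T.Adj x w) (hzw : z ≠ w) : 2 ≤ T.degree x := by
  rw [← card_neighborFinset_eq_degree, ← card_pair hzw]
  exact card_le_card (by simp [insert_subset_iff, hz, hw])

theorem two_mul_card_le_freePart_add [Fintype V] [DecidableEq V] [DecidableRel T.Adj]
    {X Z₁ Z₂ Z₃ : Finset V} (h : ∀ z ∈ Z₁, z ∈ Z₂ → z ∉ Z₃) :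
    2 * #X ≤ #(T.freePart X Z₁) + #(T.freePart X Z₂) + #(T.freePart X Z₃) +
      ∑ x ∈ X, T.degree x := by
  simp only [freePart, card_filter, ← sum_add_distrib]
  rw [mul_comm, ← smul_eq_mul, ← sum_const]
  refine sum_le_sum fun x _ => ?_
  have hpos : ∀ z, T.Adj x z → 1 ≤ T.degree x := fun z hz =>
    (T.degree_pos_iff_exists_adj x).mpr ⟨z, hz⟩
  have htwo : ∀ z w, T.Adj x z → T.Adj x w → z ≠ w → 2 ≤ T.degree x :=
    fun _ _ => two_le_degree_of_adj
  split_ifs <;> grind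

theorem two_mul_card_le_freePart_union_add [Fintype V] [DecidableEq V] [DecidableRel T.Adj]
    {X Z W : Finset V} (h : Disjoint Z W) :
    2 * #X ≤ #(T.freePart X Z ∪ T.freePart X W) + #(T.freePart X univ) +
      ∑ x ∈ X, T.degree x := by
  have hunion : T.freePart X Z ∪ T.freePart X W =
      {x ∈ X | (∀ z ∈ Z, ¬ T.Adj x z) ∨ ∀ z ∈ W, ¬ T.Adj x z} := by
    ext x
    simp only [mem_union, mem_freePart, mem_filter]
    tauto
  rw [hunion]
  simp only [freePart, card_filter, ← sum_add_distrib]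
  rw [mul_comm, ← smul_eq_mul, ← sum_const]
  refine sum_le_sum fun x _ => ?_
  have hpos : ∀ z, T.Adj x z → 1 ≤ T.degree x := fun z hz =>
    (T.degree_pos_iff_exists_adj x).mpr ⟨z, hz⟩
  have htwo : ∀ z w, T.Adj x z → T.Adj x w → z ≠ w → 2 ≤ T.degree x :=
    fun _ _ => two_le_degree_of_adj
  have hd := Finset.disjoint_left.mp h
  split_ifs <;> grind

theorem IsAcyclic.sum_degree_add_card_freePart_le [Fintype V] [DecidableEq V]
    [DecidableRel T.Adj] (h : T.IsAcyclic) {Y : Finset V}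
    (hY : T.IsBipartiteWith Y (Yᶜ : Finset V)) :
    ∑ x ∈ Yᶜ, T.degree x + #(T.freePart Yᶜ univ) ≤ Fintype.card V := by
  rw [isBipartiteWith_sum_degrees_eq_card_edges' hY]
  refine le_trans (Nat.add_le_add_left (card_le_card fun x hx => ?_) _)
    h.card_edgeFinset_add_card_isolated_le
  rw [mem_freePart] at hx
  rw [mem_filter, degree_eq_zero]
  exact ⟨mem_univ _, fun z => hx.2 z (mem_univ z)⟩

/-- Each side of a splitting of the part `Y` is extended by vertices of `Yᶜ` to a class. -/
theorem IsAcyclic.equitablyColorable_three_of_splitting [Fintype V] [DecidableEq V]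
    [DecidableRel T.Adj] (h : T.IsAcyclic) {Y Z : Finset V}
    (hY : T.IsBipartiteWith Y (Yᶜ : Finset V)) (hZY : Z ⊆ Y) (hYq : #Y < Fintype.card V / 3)
    (hZ : Fintype.card V / 3 ≤ #Z + #(T.freePart Yᶜ Z))
    (hZ' : Fintype.card V / 3 ≤ #(Y \ Z) + #(T.freePart Yᶜ (Y \ Z))) :
    T.EquitablyColorable 3 := by
  wlog hle : #(Y \ Z) + #(T.freePart Yᶜ (Y \ Z)) ≤ #Z + #(T.freePart Yᶜ Z) generalizing Z
  · refine this (Z := Y \ Z) sdiff_subset hZ' ?_ ?_ <;> rw [Finset.sdiff_sdiff_eq_self hZY]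
    · exact hZ
    · omega
  have hadj : ∀ ⦃u v⦄, T.Adj u v → (u ∈ Y ↔ v ∉ Y) := fun _ _ => hY.mem_iff_notMem_of_adj
  have hcompl := card_add_card_compl Y
  have hcardZ := card_sdiff_add_card_eq_card hZY
  have hdeg := h.sum_degree_add_card_freePart_le hY
  have hsum := two_mul_card_le_freePart_add (T := T) (X := Yᶜ) (Z₁ := Z) (Z₂ := Y \ Z)
    (Z₃ := univ) (by grind)
  have hunion := two_mul_card_le_freePart_union_add (T := T) (X := Yᶜ) (Z := Z) (W := Y \ Z)
    disjoint_sdiff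
  obtain ⟨R, hR, R', hR', hRR', hRcard, hRcard'⟩ := exists_disjoint_subsets_card_eq
    (s := T.freePart Yᶜ Z) (t := T.freePart Yᶜ (Y \ Z))
    (a := Fintype.card V / 3 + Fintype.card V % 3 / 2 - #Z)
    (b := Fintype.card V / 3 - #(Y \ Z)) (by omega) (by omega) (by omega)
  have hRZ : ∀ x ∈ R, x ∉ Y ∧ ∀ z ∈ Z, ¬ T.Adj x z := fun x hx => by
    simpa [mem_freePart] using hR hx
  have hRZ' : ∀ x ∈ R', x ∉ Y ∧ ∀ z ∈ Y \ Z, ¬ T.Adj x z := fun x hx => by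
    have := mem_freePart.mp (hR' hx)
    rwa [mem_compl] at this
  have hd := Finset.disjoint_left.mp hRR'
  have hA : #(Z ∪ R) = Fintype.card V / 3 + Fintype.card V % 3 / 2 := by
    rw [card_union_of_disjoint, hRcard]
    · omega
    · exact Finset.disjoint_left.mpr fun x hx hx' => (hRZ x hx').1 (hZY hx)
  have hB : #((Y \ Z) ∪ R') = Fintype.card V / 3 := by
    rw [card_union_of_disjoint, hRcard']
    · omega
    · exact Finset.disjoint_left.mpr fun x hx hx' => (hRZ' x hx').1 (mem_sdiff.mp hx).1
  refine EquitablyColorable.of_partition_three (q := Fintype.card V / 3) (A := Z ∪ R)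
    (B := (Y \ Z) ∪ R') ?_ ?_ ?_ ?_
    (by omega) (by omega) (by omega) (by omega) (by omega) (by omega)
  · rw [Finset.disjoint_left]
    grind
  · intro a ha b hb hab
    have := hadj hab
    have := hab.symm
    grind
  · intro a ha b hb hab
    have := hadj hab
    have := hab.symm
    grind
  · intro a ha ha' b hb hb' hab
    have := hadj hab
    grind

/-- If no splitting of the small part `Y` works, then the sets `Z ⊆ Y` for which
`Z ∪ T.freePart Yᶜ Z` is large form a down-set containing exactly one of `Z` and `Y \ Z`,
and a minimal set outside this family yields a contradiction by counting. -/
theorem IsAcyclic.equitablyColorable_three_of_card_lt [Fintype V] [DecidableEq V]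
    (h : T.IsAcyclic) {Y : Finset V} (hY : T.IsBipartiteWith Y (Yᶜ : Finset V))
    (hYq : #Y < Fintype.card V / 3)
    (hS : ∀ v, ∃ S : Finset V, v ∈ S ∧ (∀ a ∈ S, ∀ b ∈ S, ¬ T.Adj a b) ∧
      Fintype.card V / 3 ≤ #S) :
    T.EquitablyColorable 3 := by
  classical
  by_contra hcol
  obtain ⟨q, hq⟩ : ∃ q, q = Fintype.card V / 3 := ⟨_, rfl⟩
  obtain ⟨f, hf⟩ : ∃ f : Finset V → ℕ, ∀ Z, f Z = #Z + #(T.freePart Yᶜ Z) := ⟨_, fun _ => rfl⟩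
  have hcompl := card_add_card_compl Y
  have hdeg := h.sum_degree_add_card_freePart_le hY
  have hno : ∀ Z ⊆ Y, q ≤ f Z → f (Y \ Z) < q := by
    intro Z hZY hZ
    by_contra! hZ'
    rw [hf, hq] at hZ hZ'
    exact hcol (h.equitablyColorable_three_of_splitting hY hZY hYq hZ hZ')
  have hsum : ∀ Z ⊆ Y, 2 * q + 1 ≤ f Z + f (Y \ Z) := by
    intro Z hZY
    have := two_mul_card_le_freePart_add (T := T) (X := Yᶜ) (Z₁ := Z) (Z₂ := Y \ Z)
      (Z₃ := univ) (by grind)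
    have := card_sdiff_add_card_eq_card hZY
    rw [hf, hf]
    omega
  have hstep : ∀ y Z, insert y Z ⊆ Y → q ≤ f (insert y Z) → q ≤ f Z := by
    intro y Z hZY hZ
    have h₁ := hno _ hZY hZ
    have h₂ := hsum _ hZY
    have h₃ := card_insert_le y Z
    have h₄ := card_le_card (freePart_anti (T := T) (X := Yᶜ) (subset_insert y Z))
    rw [hf] at h₂ ⊢
    omega
  have hdown : ∀ Z D, Z ∪ D ⊆ Y → q ≤ f (Z ∪ D) → q ≤ f Z := by
    intro Z D
    induction D using Finset.induction_on with
    | empty => simp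
    | insert y D _ ih =>
      intro hZY hZ
      rw [union_insert] at hZY hZ
      exact ih ((subset_insert _ _).trans hZY) (hstep y _ hZY hZ)
  have hsingle : ∀ y ∈ Y, q ≤ f {y} := by
    intro y hy
    obtain ⟨S, hyS, hS, hcard⟩ := hS y
    have hunion : {y} ∪ (S ∩ Y) = S ∩ Y := by grind
    refine hdown {y} (S ∩ Y) (by rw [hunion]; exact inter_subset_right) ?_
    have hsub : S \ Y ⊆ T.freePart Yᶜ (S ∩ Y) := by
      intro x hx
      rw [mem_sdiff] at hx
      rw [mem_freePart, mem_compl]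
      exact ⟨hx.2, fun z hz => hS x hx.1 z (mem_inter.mp hz).1⟩
    have := card_le_card hsub
    have := card_inter_add_card_sdiff S Y
    rw [hunion, hf]
    omega
  have hempty : q ≤ f ∅ := by
    have : T.freePart Yᶜ ∅ = Yᶜ := by ext; simp [mem_freePart]
    rw [hf, this]
    omega
  have hYf : f Y < q := by simpa using hno ∅ (empty_subset _) hempty
  obtain ⟨M, hM, hmin⟩ := exists_min_image (Y.powerset.filter fun Z => f Z < q) card
    ⟨Y, by simpa using hYf⟩
  simp only [mem_filter, mem_powerset] at hM hmin
  obtain ⟨hMY, hMf⟩ := hM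
  obtain ⟨y, hy⟩ : M.Nonempty := by
    rw [Finset.nonempty_iff_ne_empty]
    rintro rfl
    omega
  have hP : q ≤ f (M.erase y) := by
    by_contra! hlt
    have := hmin _ ⟨(erase_subset _ _).trans hMY, hlt⟩
    have := card_erase_lt_of_mem hy
    omega
  have h₁ := hno _ ((erase_subset _ _).trans hMY) hP
  have h₂ := hno _ (singleton_subset_iff.mpr (hMY hy)) (hsingle y (hMY hy))
  have h₃ := two_mul_card_le_freePart_add (T := T) (X := Yᶜ) (Z₁ := Y \ M.erase y)
    (Z₂ := Y \ {y}) (Z₃ := M) (by grind)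
  have h₄ := card_sdiff_add_card_eq_card ((erase_subset y M).trans hMY)
  have h₅ := card_sdiff_add_card_eq_card (singleton_subset_iff.mpr (hMY hy))
  have h₆ := card_erase_add_one hy
  rw [card_singleton] at h₅
  rw [hf] at h₁ h₂ hMf
  omega

theorem IsAcyclic.equitablyColorable_three [Fintype V] (h : T.IsAcyclic)
    (hS : ∀ v, ∃ S : Finset V, v ∈ S ∧ (∀ a ∈ S, ∀ b ∈ S, ¬ T.Adj a b) ∧
      Fintype.card V / 3 ≤ #S) :
    T.EquitablyColorable 3 := by
  classical
  rcases le_total (Fintype.card V) 3 with hn | hn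
  · exact EquitablyColorable.of_card_le T hn
  · obtain ⟨Y, hY, hhalf⟩ := h.exists_bipartition
    rcases le_or_gt (Fintype.card V / 3) #Y with hYq | hYq
    · exact hY.equitablyColorable_three_of_le_card h.card_edgeFinset_le hhalf hn hYq
    · exact h.equitablyColorable_three_of_card_lt hY hYq hS

theorem card_bounds_of_equitable [Fintype V] {k : ℕ} {f : V → Fin k}
    (hf : ∀ c c' : Fin k, #{v | f v = c} ≤ #{v | f v = c'} + 1) (c : Fin k) :
    Fintype.card V < k * (#{v | f v = c} + 1) ∧ k * #{v | f v = c} < Fintype.card V + k := by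
  have hsum : ∑ c', #{v | f v = c'} = Fintype.card V := by
    rw [← card_univ, card_eq_sum_card_fiberwise (f := f) (t := univ) (by simp)]
  rw [← add_sum_erase univ _ (mem_univ c)] at hsum
  have hcard : #(univ.erase c) + 1 = k := by
    rw [card_erase_add_one (mem_univ c), card_univ, Fintype.card_fin]
  have hle : ∑ c' ∈ univ.erase c, #{v | f v = c'} ≤ #(univ.erase c) * (#{v | f v = c} + 1) :=
    sum_le_card_nsmul _ _ _ fun c' _ => hf c' c
  have hge : ∑ _c' ∈ univ.erase c, #{v | f v = c} ≤
      ∑ c' ∈ univ.erase c, (#{v | f v = c'} + 1) := sum_le_sum fun c' _ => hf c c'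
  simp only [sum_const, smul_eq_mul, sum_add_distrib, mul_one] at hge
  generalize #(univ.erase c) = j at *
  subst hcard
  constructor <;> nlinarith

theorem _root_.Finset.card_setOf_notMem_add_card [Fintype V] [DecidableEq V] (I : Finset V) :
    Fintype.card {v | v ∉ I} + #I = Fintype.card V := by
  rw [← card_compl_add_card I]
  congr 1
  rw [Fintype.card_subtype]
  congr 1
  ext v
  simp

/-- An independent set of the right size can be used as an additional color class. -/
theorem EquitablyColorable.succ_of_induce [Fintype V] [DecidableEq V] {k : ℕ} {I : Finset V}
    (hI : ∀ a ∈ I, ∀ b ∈ I, ¬ T.Adj a b) (hcard : #I = Fintype.card V / (k + 1))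
    (h : (T.induce {v | v ∉ I}).EquitablyColorable k) : T.EquitablyColorable (k + 1) := by
  obtain ⟨g, hg, hgcard⟩ := h
  obtain ⟨f, hf⟩ : ∃ f : V → Fin (k + 1), ∀ v, f v =
      if hv : v ∉ I then (g ⟨v, hv⟩).castSucc else Fin.last k := ⟨_, fun _ => rfl⟩
  have hlast : ({v | f v = Fin.last k} : Finset V) = I := by
    ext v
    simp only [mem_filter, mem_univ, true_and, hf]
    split_ifs with hv
    · simpa [Fin.castSucc_ne_last] using hv
    · simpa using hv
  have hcast : ∀ c : Fin k, #{v | f v = c.castSucc} = #{v | g v = c} := by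
    intro c
    rw [← card_map (Function.Embedding.subtype _)]
    congr 1
    ext v
    simp only [mem_filter, mem_univ, true_and, hf, mem_map, Function.Embedding.subtype_apply,
      Subtype.exists, exists_and_right, exists_eq_right]
    split_ifs with hv
    · simp [hv, (Fin.castSucc_ne_last c).symm]
    · simp [hv]
  have hn := I.card_setOf_notMem_add_card
  have hdiv := Nat.div_add_mod (Fintype.card V) (k + 1)
  have hmod : Fintype.card V % (k + 1) < k + 1 := Nat.mod_lt _ k.succ_pos
  rw [← hcard] at hdiv
  have hclass : ∀ c, #I ≤ #{v | f v = c} ∧ #{v | f v = c} ≤ #I + 1 := by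
    intro c
    cases c using Fin.lastCases with
    | last => rw [hlast]; omega
    | cast c =>
      rw [hcast]
      obtain ⟨h₁, h₂⟩ := card_bounds_of_equitable hgcard c
      constructor <;> by_contra! hlt <;>
        have := Nat.mul_le_mul_left k (Nat.add_one_le_iff.mpr hlt) <;>
        simp only [mul_add, add_mul] at * <;> omega
  refine ⟨f, fun u v huv => ?_, fun c c' => ?_⟩
  · rw [hf, hf]
    split_ifs with hu hv hv
    · exact absurd huv (hI u hu v hv)
    · exact (Fin.castSucc_ne_last _).symm
    · exact Fin.castSucc_ne_last _
    · exact fun heq => hg (u := ⟨u, hu⟩) (v := ⟨v, hv⟩) huv (Fin.castSucc_injective k heq)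
  · have := (hclass c).2
    have := (hclass c').1
    omega

/-- After deleting an independent set containing a vertex of maximum degree, every remaining
vertex of a forest lies in a large independent set. -/
theorem IsAcyclic.exists_independent_disjoint [Fintype V] [DecidableEq V] [DecidableRel T.Adj]
    (h : T.IsAcyclic) {I : Finset V} (hI : ∀ a ∈ I, ∀ b ∈ I, ¬ T.Adj a b) {w : V} (hw : w ∈ I)
    (hmax : ∀ v, T.degree v ≤ T.degree w) {q : ℕ} (hq : 3 * q + #I ≤ Fintype.card V) {v : V}
    (hv : v ∉ I) :
    ∃ S : Finset V, Disjoint S I ∧ v ∈ S ∧ (∀ a ∈ S, ∀ b ∈ S, ¬ T.Adj a b) ∧ q ≤ #S := by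
  obtain ⟨Y, hY, -⟩ := h.exists_bipartition
  have hadj : ∀ ⦃u v⦄, T.Adj u v → (u ∈ Y ↔ v ∉ Y) := fun _ _ => hY.mem_iff_notMem_of_adj
  have hinsert : ∀ W : Finset V, Disjoint W I → (∀ a ∈ W, ¬ T.Adj v a) →
      (∀ a ∈ W, ∀ b ∈ W, ¬ T.Adj a b) → v ∉ W → q ≤ #W + 1 →
      ∃ S : Finset V, Disjoint S I ∧ v ∈ S ∧ (∀ a ∈ S, ∀ b ∈ S, ¬ T.Adj a b) ∧ q ≤ #S := by
    intro W hWI hvW hW hv' hcard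
    refine ⟨insert v W, by simp [hv, hWI], mem_insert_self _ _, ?_, by simpa [hv'] using hcard⟩
    intro a ha b hb hab
    have := hab.symm
    have := hab.ne
    grind
  rcases le_or_gt (q + 2) (T.degree v) with hdeg | hdeg
  · have hwv : w ≠ v := fun heq => hv (heq ▸ hw)
    have hcommon := h.card_inter_neighborFinset_le_one hwv
    have hcard := card_inter_add_card_sdiff (T.neighborFinset w) (T.neighborFinset v)
    rw [card_neighborFinset_eq_degree] at hcard
    have hle := hmax v
    refine hinsert ((T.neighborFinset w \ T.neighborFinset v).erase v) ?_ ?_ ?_ ?_ ?_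
    · rw [Finset.disjoint_left]
      intro a ha haI
      simp only [mem_erase, mem_sdiff, mem_neighborFinset] at ha
      exact hI w hw a haI ha.2.1
    · intro a ha
      simp only [mem_erase, mem_sdiff, mem_neighborFinset] at ha
      exact ha.2.2
    · intro a ha b hb hab
      simp only [mem_erase, mem_sdiff, mem_neighborFinset] at ha hb
      have := hadj hab
      have := hadj ha.2.1
      have := hadj hb.2.1
      tauto
    · simp
    · have := pred_card_le_card_erase (s := T.neighborFinset w \ T.neighborFinset v) (a := v)
      omega
  · obtain ⟨W, hW⟩ : ∃ W, W = (I ∪ insert v (T.neighborFinset v))ᶜ := ⟨_, rfl⟩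
    have hmem : ∀ a, a ∈ W ↔ a ∉ I ∧ a ≠ v ∧ ¬ T.Adj v a := by
      intro a
      simp only [hW, mem_compl, mem_union, mem_insert, mem_neighborFinset, not_or, ne_eq]
    have hWcard : Fintype.card V ≤ #W + (#I + (T.degree v + 1)) := by
      rw [hW, ← card_compl_add_card (I ∪ insert v (T.neighborFinset v))]
      refine Nat.add_le_add_left ((card_union_le _ _).trans (Nat.add_le_add_left ?_ _)) _
      exact (card_insert_le _ _).trans (by simp)
    have hsplit := card_inter_add_card_sdiff W Y
    have hside : ∀ U ⊆ W, (∀ a ∈ U, ∀ b ∈ U, (a ∈ Y ↔ b ∈ Y)) → q ≤ #U + 1 →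
        ∃ S : Finset V, Disjoint S I ∧ v ∈ S ∧ (∀ a ∈ S, ∀ b ∈ S, ¬ T.Adj a b) ∧ q ≤ #S := by
      intro U hU hUY hcard
      refine hinsert U ?_ ?_ ?_ ?_ hcard
      · exact Finset.disjoint_left.mpr fun a ha => ((hmem a).mp (hU ha)).1
      · exact fun a ha => ((hmem a).mp (hU ha)).2.2
      · intro a ha b hb hab
        have := hadj hab
        have := hUY a ha b hb
        tauto
      · exact fun hvU => ((hmem v).mp (hU hvU)).2.1 rfl
    rcases le_or_gt q (#(W ∩ Y) + 1) with hle | hlt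
    · exact hside (W ∩ Y) inter_subset_left (by grind) hle
    · exact hside (W \ Y) sdiff_subset (by grind) (by omega)

theorem IsAcyclic.equitablyColorable [Fintype V] (h : T.IsAcyclic) {k : ℕ} (hk : 3 ≤ k)
    (hS : ∀ v, ∃ S : Finset V, v ∈ S ∧ (∀ a ∈ S, ∀ b ∈ S, ¬ T.Adj a b) ∧
      Fintype.card V / k ≤ #S) :
    T.EquitablyColorable k := by
  classical
  induction k, hk using Nat.le_induction generalizing V with
  | base => exact h.equitablyColorable_three hS
  | succ k hk ih =>
    rcases le_total (Fintype.card V) (k + 1) with hn | hn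
    · exact EquitablyColorable.of_card_le T hn
    have hne : Nonempty V := Fintype.card_pos_iff.mp (by omega)
    obtain ⟨w, -, hmax⟩ := exists_max_image univ (fun v => T.degree v) univ_nonempty
    obtain ⟨S, hwS, hindep, hcard⟩ := hS w
    obtain ⟨I, hwI, hIS, hIcard⟩ := exists_subsuperset_card_eq
      (singleton_subset_iff.mpr hwS) (n := Fintype.card V / (k + 1))
      (by rw [card_singleton]; exact Nat.div_pos hn (Nat.succ_pos k)) hcard
    rw [singleton_subset_iff] at hwI
    have hI : ∀ a ∈ I, ∀ b ∈ I, ¬ T.Adj a b := fun a ha b hb => hindep a (hIS ha) b (hIS hb)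
    have hcompl := I.card_setOf_notMem_add_card
    refine EquitablyColorable.succ_of_induce hI hIcard (ih (h.induce _) fun v => ?_)
    have hq := Nat.mul_le_mul_right (Fintype.card {v | v ∉ I} / k) hk
    have hq' := Nat.mul_div_le (Fintype.card {v | v ∉ I}) k
    obtain ⟨S', hS'I, hvS', hS', hcard'⟩ := h.exists_independent_disjoint hI hwI
      (fun v => hmax v (mem_univ v)) (q := Fintype.card {v | v ∉ I} / k) (by omega) v.2
    refine ⟨S'.subtype _, by simpa using hvS', fun a ha b hb => ?_, ?_⟩
    · rw [mem_subtype] at ha hb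
      exact hS' a ha b hb
    · rw [card_subtype, filter_true_of_mem]
      · exact hcard'
      · exact fun x hx => Finset.disjoint_left.mp hS'I hx

end SimpleGraph

end

/-- **Chen–Lih / Miyata–Tokunaga–Kaneko.** A forest `T` on `n` vertices has an equitable
`k`-coloring (`k ≥ 3`) if and only if every vertex `v` lies in an independent set of
size at least `⌊n/k⌋`. -/
theorem forest_equitable_iff {V : Type*} [Fintype V] (T : SimpleGraph V)
    (hforest : T.IsAcyclic) (k : ℕ) (hk : 3 ≤ k) :
    (∃ f : V → Fin k,
      (∀ ⦃u v : V⦄, T.Adj u v → f u ≠ f v) ∧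
      (∀ c c' : Fin k,
        (Finset.univ.filter fun v => f v = c).card ≤
          (Finset.univ.filter fun v => f v = c').card + 1)) ↔
    (∀ v : V, ∃ S : Finset V, v ∈ S ∧ (∀ a ∈ S, ∀ b ∈ S, ¬ T.Adj a b) ∧
      Fintype.card V / k ≤ S.card) := by
  constructor
  · rintro ⟨f, hf, hcard⟩ v
    refine ⟨Finset.univ.filter fun u => f u = f v, by simp, fun a ha b hb hab => ?_, ?_⟩
    · simp only [Finset.mem_filter, Finset.mem_univ, true_and] at ha hb
      exact hf hab (ha.trans hb.symm)
    · have := (SimpleGraph.card_bounds_of_equitable hcard (f v)).1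
      exact Nat.le_of_lt_succ (Nat.div_lt_of_lt_mul this)
  · exact hforest.equitablyColorable hk
end

section
/- Let d ≥ 2 and Δ ≥ 27d be integers and let k ≥ (d + Δ + 1)/2. Then every d-degenerate graph with maximum degree at most Δ has an equitable k-coloring. -/
namespace EquitableColoring
open Finset
section
open scoped Classical

variable {V : Type*}

/-- The number of neighbours of `v` in `X`. -/
noncomputable def degIn (G : SimpleGraph V) (X : Finset V) (v : V) : ℕ := #{u ∈ X | G.Adj v u}

/-- The number of ordered pairs of adjacent vertices in `X`. -/
noncomputable def arcs (G : SimpleGraph V) (X : Finset V) : ℕ := ∑ x ∈ X, degIn G X x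

/-- Every nonempty finite set of vertices contains a vertex with at most `d` neighbours in it. -/
def Degenerate (G : SimpleGraph V) (d : ℕ) : Prop :=
  ∀ A : Finset V, A.Nonempty → ∃ v ∈ A, degIn G A v ≤ d

/-- `f` is a proper coloring of the subgraph induced on `U`. -/
def ProperOn {k : ℕ} (G : SimpleGraph V) (U : Finset V) (f : V → Fin k) : Prop :=
  ∀ u ∈ U, ∀ v ∈ U, G.Adj u v → f u ≠ f v

variable {G : SimpleGraph V} {d k t h : ℕ}

theorem degIn_mono {X Y : Finset V} (hXY : X ⊆ Y) (v : V) : degIn G X v ≤ degIn G Y v :=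
  card_le_card (filter_subset_filter _ hXY)

theorem degIn_union {X Y : Finset V} (hXY : Disjoint X Y) (v : V) :
    degIn G (X ∪ Y) v = degIn G X v + degIn G Y v := by
  unfold degIn
  rw [filter_union, card_union_of_disjoint (disjoint_filter_filter hXY)]

theorem sum_degIn_comm (X Y : Finset V) :
    ∑ x ∈ X, degIn G Y x = ∑ y ∈ Y, degIn G X y := by
  unfold degIn
  simp only [card_filter]
  rw [sum_comm]
  simp only [G.adj_comm]

theorem arcs_union {X Y : Finset V} (hXY : Disjoint X Y) :
    arcs G (X ∪ Y) = arcs G X + 2 * ∑ y ∈ Y, degIn G X y + arcs G Y := by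
  unfold arcs
  rw [sum_union hXY]
  simp only [degIn_union hXY, sum_add_distrib]
  rw [sum_degIn_comm X Y]
  ring

theorem arcs_mono {X Y : Finset V} (hXY : X ⊆ Y) : arcs G X ≤ arcs G Y :=
  (sum_le_sum fun x _ => degIn_mono hXY x).trans (sum_le_sum_of_subset hXY)

theorem arcs_erase {X : Finset V} {w : V} (hw : w ∈ X) :
    arcs G X = arcs G (X.erase w) + 2 * degIn G X w := by
  have h1 : X = X.erase w ∪ {w} := by
    ext x; by_cases hx : x = w <;> simp [hx, hw]
  have h2 : Disjoint (X.erase w) {w} := by simp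
  have h3 : degIn G {w} w = 0 := by simp [degIn, filter_singleton]
  have h4 : degIn G X w = degIn G (X.erase w) w := by
    conv_lhs => rw [h1]
    rw [degIn_union h2, h3, add_zero]
  conv_lhs => rw [h1]
  rw [arcs_union h2, h4]
  simp [arcs, h3]

theorem Degenerate.arcs_le (hG : Degenerate G d) (X : Finset V) : arcs G X ≤ 2 * d * #X := by
  induction hn : #X generalizing X with
  | zero => simp_all [arcs]
  | succ n ih =>
    obtain ⟨v, hv, hvd⟩ := hG X (card_pos.1 (by omega))
    rw [arcs_erase hv]
    have := ih (X.erase v) (by rw [card_erase_of_mem hv]; omega)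
    nlinarith

theorem two_mul_cross_le {X Z W : Finset V} (hX : X ⊆ W) (hZ : Z ⊆ W) (hXZ : Disjoint X Z) :
    2 * ∑ z ∈ Z, degIn G X z ≤ arcs G W := by
  have := arcs_mono (G := G) (union_subset hX hZ)
  rw [arcs_union hXZ] at this
  omega

/-- Greedily removing vertices of large remaining degree. -/
theorem exists_heavy (G : SimpleGraph V) (W : Finset V) (T : ℚ) :
    ∃ K ⊆ W, (∀ w ∈ W \ K, (degIn G (W \ K) w : ℚ) ≤ T) ∧
      ∀ Y ⊆ K, 2 * T * #Y + arcs G (W \ Y) ≤ arcs G W := by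
  let P : Finset V → Prop := fun K => ∀ Y ⊆ K, 2 * T * #Y + arcs G (W \ Y) ≤ arcs G W
  have hne : {K ∈ W.powerset | P K}.Nonempty :=
    ⟨∅, by simp [P, subset_empty]⟩
  obtain ⟨K, hK, hmax⟩ := exists_max_image _ (fun K => #K) hne
  simp only [mem_filter, mem_powerset] at hK hmax
  refine ⟨K, hK.1, fun w hw => ?_, hK.2⟩
  by_contra! hlt
  rw [mem_sdiff] at hw
  have := hmax (insert w K) ⟨insert_subset hw.1 hK.1, fun Y hY => ?_⟩
  · rw [card_insert_of_notMem hw.2] at this; omega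
  by_cases hwY : w ∈ Y
  · have hY' : Y.erase w ⊆ K := by
      intro x hx
      rw [mem_erase] at hx
      exact (mem_insert.1 (hY hx.2)).resolve_left hx.1
    have h1 := hK.2 _ hY'
    have h2 : w ∈ W \ Y.erase w := by simp [hw.1]
    have h3 := arcs_erase (G := G) h2
    have h4 : (W \ Y.erase w).erase w = W \ Y := by
      ext x; by_cases hx : x = w <;> simp [hx, hwY]
    rw [h4] at h3
    have h5 : degIn G (W \ K) w ≤ degIn G (W \ Y.erase w) w :=
      degIn_mono (sdiff_subset_sdiff le_rfl hY') w
    have h6 : (#(Y.erase w) : ℚ) = #Y - 1 := by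
      rw [card_erase_of_mem hwY, Nat.cast_sub (card_pos.2 ⟨w, hwY⟩)]; simp
    rw [h6, h3] at h1
    push_cast at h1
    have h7 : (degIn G (W \ K) w : ℚ) ≤ degIn G (W \ Y.erase w) w := by exact_mod_cast h5
    linarith
  · exact hK.2 Y fun x hx => (mem_insert.1 (hY hx)).resolve_left (by rintro rfl; exact hwY hx)

/-- Any set of vertices extends, by few further vertices, to one above which all vertex sets
can be peeled off one vertex of degree less than `m` at a time. -/
theorem Degenerate.exists_peeling_base (hG : Degenerate G d) {K W : Finset V} (hKW : K ⊆ W)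
    (m : ℕ) :
    ∃ H ⊆ W, K ⊆ H ∧ m * #(H \ K) ≤ d * #K + 2 * d * #(H \ K) ∧
      ∀ U, H ⊂ U → U ⊆ W → ∃ v ∈ U \ H, degIn G U v < m := by
  let P : Finset V → Prop := fun H => K ⊆ H ∧ ∀ v ∈ H \ K, m ≤ degIn G H v
  have hne : {H ∈ W.powerset | P H}.Nonempty := ⟨K, by simp +contextual [P, hKW]⟩
  obtain ⟨H, hH, hmax⟩ := exists_max_image _ (fun K => #K) hne
  simp only [mem_filter, mem_powerset] at hH hmax
  obtain ⟨hHW, hKH, hH⟩ := hH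
  refine ⟨H, hHW, hKH, ?_, fun U hHU hUW => ?_⟩
  · have h1 : H \ K ∪ K = H := sdiff_union_of_subset hKH
    have h2 : Disjoint (H \ K) K := sdiff_disjoint
    have h3 := arcs_union (G := G) h2
    have h4 : ∑ x ∈ H \ K, degIn G H x = arcs G (H \ K) + ∑ y ∈ K, degIn G (H \ K) y := by
      rw [sum_degIn_comm K, arcs, ← sum_add_distrib]
      exact sum_congr rfl fun x _ => by rw [← degIn_union h2, h1]
    have h5 : #(H \ K) * m ≤ ∑ x ∈ H \ K, degIn G H x := by
      rw [← smul_eq_mul]; exact card_nsmul_le_sum _ _ _ hH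
    have h6 := hG.arcs_le (H \ K ∪ K)
    have h7 := hG.arcs_le (H \ K)
    rw [card_union_of_disjoint h2] at h6
    nlinarith
  · by_contra! hcon
    refine absurd (hmax U ⟨hUW, hKH.trans hHU.subset, fun v hv => ?_⟩) (by
      have := card_lt_card hHU; omega)
    by_cases hvH : v ∈ H
    · exact (hH v (mem_sdiff.2 ⟨hvH, (mem_sdiff.1 hv).2⟩)).trans (degIn_mono hHU.subset v)
    · exact hcon v (mem_sdiff.2 ⟨(mem_sdiff.1 hv).1, hvH⟩)

/-- Some vertex of `U \ H` of color `c` has no neighbour of color `c'` in `U`. -/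
def CanMove (G : SimpleGraph V) (U H : Finset V) (f : V → Fin k) (c c' : Fin k) : Prop :=
  ∃ y ∈ U, y ∉ H ∧ f y = c ∧ ∀ u ∈ U, f u = c' → ¬ G.Adj y u

theorem ProperOn.update_insert {U : Finset V} {f : V → Fin k} (hf : ProperOn G U f) {y : V}
    {c : Fin k} (hy : ∀ u ∈ U, f u = c → ¬ G.Adj y u) :
    ProperOn G (insert y U) (Function.update f y c) := by
  intro u hu w hw huw
  have hne := huw.ne
  by_cases h1 : u = y
  · subst h1
    rw [Function.update_self, Function.update_of_ne hne.symm]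
    intro h2
    exact hy w ((mem_insert.1 hw).resolve_left hne.symm) h2.symm huw
  · by_cases h2 : w = y
    · subst h2
      rw [Function.update_self, Function.update_of_ne hne]
      intro h3
      exact hy u ((mem_insert.1 hu).resolve_left hne) h3 huw.symm
    · rw [Function.update_of_ne h1, Function.update_of_ne h2]
      exact hf u ((mem_insert.1 hu).resolve_left h1) w ((mem_insert.1 hw).resolve_left h2) huw

theorem extend_along_path {U H : Finset V} {v : V} (hv : v ∉ U) (hHU : H ⊆ U) (m : ℕ) :
    ∀ (f : V → Fin k) (p : ℕ → Fin k), ProperOn G U f → (∀ c, #{u ∈ U | f u = c} ≤ t) →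
      Set.InjOn p (Set.Iic m) → (∀ i < m, CanMove G U H f (p i) (p (i + 1))) →
      #{u ∈ U | f u = p m} < t → (∀ u ∈ U, f u = p 0 → ¬ G.Adj v u) →
      ∃ f' : V → Fin k, ProperOn G (insert v U) f' ∧
        (∀ c, #{u ∈ insert v U | f' u = c} ≤ t) ∧ ∀ x ∈ H, f' x = f x := by
  induction m with
  | zero =>
    intro f p hf hcap _ _ hlt hadj
    refine ⟨Function.update f v (p 0), hf.update_insert hadj, fun c => ?_, fun x hx => ?_⟩
    · have h1 : {u ∈ U | Function.update f v (p 0) u = c} = {u ∈ U | f u = c} :=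
        filter_congr fun u hu => by rw [Function.update_of_ne (by rintro rfl; exact hv hu)]
      rw [filter_insert, Function.update_self, h1]
      split_ifs with h2
      · subst h2
        exact (card_insert_le _ _).trans hlt
      · exact hcap c
    · exact Function.update_of_ne (by rintro rfl; exact hv (hHU hx)) _ _
  | succ m ih =>
    intro f p hf hcap hinj hmove hlt hadj
    obtain ⟨y, hyU, hyH, hyc, hyadj⟩ := hmove m (Nat.lt_succ_self m)
    have hp : ∀ i, i ≤ m → p i ≠ p (m + 1) := fun i hi h1 => by
      have := hinj (Set.mem_Iic.2 (by omega)) (Set.mem_Iic.2 le_rfl) h1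
      omega
    set g := Function.update f y (p (m + 1)) with hg
    have hgU : ProperOn G U g := by
      have := hf.update_insert hyadj
      rwa [insert_eq_of_mem hyU] at this
    have hclass : ∀ c, c ≠ p (m + 1) → {u ∈ U | g u = c} ⊆ {u ∈ U | f u = c} := by
      intro c hc u hu
      simp only [mem_filter] at hu ⊢
      refine ⟨hu.1, ?_⟩
      by_cases huy : u = y
      · subst huy
        rw [hg, Function.update_self] at hu
        exact absurd hu.2.symm hc
      · rw [← hu.2, hg, Function.update_of_ne huy]
    have hgf : ∀ c, c ≠ p (m + 1) → ∀ u ∈ U, g u = c → f u = c := fun c hc u hu h1 =>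
      (mem_filter.1 (hclass c hc (mem_filter.2 ⟨hu, h1⟩))).2
    have key := ih g p hgU ?_ ?_ ?_ ?_ ?_
    · obtain ⟨f', h1, h2, h3⟩ := key
      refine ⟨f', h1, h2, fun x hx => ?_⟩
      rw [h3 x hx, hg, Function.update_of_ne (by rintro rfl; exact hyH hx)]
    · intro c
      by_cases hc : c = p (m + 1)
      · subst hc
        have : {u ∈ U | g u = p (m + 1)} ⊆ insert y {u ∈ U | f u = p (m + 1)} := by
          intro u hu
          simp only [mem_filter, mem_insert] at hu ⊢
          by_cases huy : u = y
          · exact Or.inl huy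
          · rw [hg, Function.update_of_ne huy] at hu
            exact Or.inr hu
        exact (card_le_card this).trans ((card_insert_le _ _).trans hlt)
      · exact (card_le_card (hclass c hc)).trans (hcap c)
    · exact hinj.mono (Set.Iic_subset_Iic.2 (by omega))
    · intro i hi
      obtain ⟨z, hzU, hzH, hzc, hzadj⟩ := hmove i (by omega)
      have hzy : z ≠ y := by
        rintro rfl
        have := hinj (Set.mem_Iic.2 (by omega)) (Set.mem_Iic.2 (by omega)) (hzc.symm.trans hyc)
        omega
      exact ⟨z, hzU, hzH, by rw [hg, Function.update_of_ne hzy, hzc],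
        fun u hu h1 => hzadj u hu (hgf _ (hp (i + 1) (by omega)) u hu h1)⟩
    · refine lt_of_lt_of_le (card_lt_card (ssubset_iff_of_subset (hclass _ (hp m le_rfl)) |>.2
        ⟨y, by simp [hyU, hyc], ?_⟩)) (hcap (p m))
      simp only [mem_filter, not_and]
      intro _ h1
      rw [hg, Function.update_self] at h1
      exact hp m le_rfl h1.symm
    · exact fun u hu h1 => hadj u hu (hgf _ (hp 0 (by omega)) u hu h1)

/-- A shortest path for a relation is injective. -/
theorem exists_injOn_path {α : Type*} {R : α → α → Prop} {Q : α → Prop} {c : α} {m : ℕ}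
    {p : ℕ → α} (h0 : p 0 = c) (hR : ∀ i < m, R (p i) (p (i + 1))) (hQ : Q (p m)) :
    ∃ (m : ℕ) (p : ℕ → α), p 0 = c ∧ (∀ i < m, R (p i) (p (i + 1))) ∧ Q (p m) ∧
      Set.InjOn p (Set.Iic m) := by
  induction m using Nat.strong_induction_on generalizing p with
  | _ m ih =>
    by_cases hinj : Set.InjOn p (Set.Iic m)
    · exact ⟨m, p, h0, hR, hQ, hinj⟩
    have : ∃ i j, i < j ∧ j ≤ m ∧ p i = p j := by
      simp only [Set.InjOn, Set.mem_Iic, not_forall] at hinj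
      obtain ⟨i, hi, j, hj, hij, hne⟩ := hinj
      rcases lt_or_gt_of_ne hne with h1 | h1
      · exact ⟨i, j, h1, hj, hij⟩
      · exact ⟨j, i, h1, hi, hij.symm⟩
    obtain ⟨i, j, hij, hjm, hpij⟩ := this
    refine ih (m - (j - i)) (by omega) (p := fun l => if l ≤ i then p l else p (l + (j - i)))
      (by simpa using h0) (fun l hl => ?_) ?_
    · rcases lt_trichotomy l i with h1 | h1 | h1
      · simp only [h1.le, if_true, Nat.succ_le_of_lt h1]
        exact hR l (by omega)
      · subst h1
        have h2 : l + 1 + (j - l) = j + 1 := by omega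
        simp only [le_refl, if_true, Nat.not_succ_le_self, if_false, h2, hpij]
        exact hR j (by omega)
      · have h2 : l + 1 + (j - i) = l + (j - i) + 1 := by omega
        simp only [not_le.2 h1, if_false, show ¬ l + 1 ≤ i by omega, h2]
        exact hR _ (by omega)
    · by_cases h1 : m - (j - i) ≤ i
      · have h2 : m - (j - i) = i := by omega
        have h3 : m = j := by omega
        subst h3
        simp only [h2, le_refl, if_true, hpij, hQ]
      · have h2 : m - (j - i) + (j - i) = m := by omega
        simp only [h1, if_false, h2, hQ]

/-- Either the coloring extends to `v` by recoloring only vertices outside `H`, or there is a set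
of colors that blocks the extension. -/
theorem extend_or_blocked {U H : Finset V} {v : V} (hv : v ∉ U) (hHU : H ⊆ U) {f : V → Fin k}
    (hf : ProperOn G U f) (hcap : ∀ c, #{u ∈ U | f u = c} ≤ t) (hU : #U < k * t) :
    (∃ f' : V → Fin k, ProperOn G (insert v U) f' ∧
        (∀ c, #{u ∈ insert v U | f' u = c} ≤ t) ∧ ∀ x ∈ H, f' x = f x) ∨
      ∃ A : Finset (Fin k), (∃ c ∈ A, #{u ∈ U | f u = c} < t) ∧
        (∀ c ∉ A, #{u ∈ U | f u = c} = t) ∧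
        (∀ c ∈ A, ∃ u ∈ U, f u = c ∧ G.Adj v u) ∧
        ∀ y ∈ U \ H, f y ∉ A → ∀ c ∈ A, ∃ u ∈ U, f u = c ∧ G.Adj y u := by
  refine or_iff_not_imp_left.2 fun hno => ?_
  refine ⟨univ.filter fun c => ∃ (m : ℕ) (p : ℕ → Fin k), p 0 = c ∧
    (∀ i < m, CanMove G U H f (p i) (p (i + 1))) ∧ #{u ∈ U | f u = p m} < t, ?_, ?_, ?_, ?_⟩
  · by_contra! hcon
    have h1 : ∀ c, t ≤ #{u ∈ U | f u = c} := fun c => by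
      by_contra! hc
      exact absurd (hcon c (mem_filter.2 ⟨mem_univ _, 0, fun _ => c, rfl, by simp, hc⟩))
        (not_le.2 hc)
    have h2 := card_eq_sum_card_fiberwise (s := U) (t := univ) (f := f) fun _ _ => mem_univ _
    have h3 : ∑ c : Fin k, t ≤ ∑ c : Fin k, #{u ∈ U | f u = c} := sum_le_sum fun c _ => h1 c
    rw [← h2] at h3
    simp at h3
    omega
  · intro c hc
    refine le_antisymm (hcap c) ?_
    by_contra! hlt
    exact hc (mem_filter.2 ⟨mem_univ _, 0, fun _ => c, rfl, by simp, hlt⟩)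
  · intro c hc
    obtain ⟨m, p, h0, hR, hQ⟩ := (mem_filter.1 hc).2
    obtain ⟨m, p, h0, hR, hQ, hinj⟩ :=
      exists_injOn_path (Q := fun c => #{u ∈ U | f u = c} < t) h0 hR hQ
    by_contra! hcon
    exact hno (extend_along_path hv hHU m f p hf hcap hinj hR hQ (by rwa [h0]))
  · intro y hy hyA c hc
    obtain ⟨m, p, h0, hR, hQ⟩ := (mem_filter.1 hc).2
    by_contra! hcon
    refine hyA (mem_filter.2 ⟨mem_univ _, m + 1, fun i => i.casesOn (f y) p, rfl, ?_, hQ⟩)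
    rintro (_ | i) hi
    · rw [mem_sdiff] at hy
      exact ⟨y, hy.1, hy.2, rfl, by simpa [h0] using hcon⟩
    · exact hR i (by omega)

theorem card_le_degIn_of_forall_color {U : Finset V} {f : V → Fin k} {A : Finset (Fin k)} {v : V}
    (hA : ∀ c ∈ A, ∃ u ∈ U, f u = c ∧ G.Adj v u) : #A ≤ degIn G {u ∈ U | f u ∈ A} v := by
  refine card_le_card_of_surjOn f fun c hc => ?_
  obtain ⟨u, hu, hfu, hadj⟩ := hA c hc
  exact ⟨u, by simp_all, hfu⟩

theorem card_filter_mem_color (U : Finset V) (f : V → Fin k) (A : Finset (Fin k)) :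
    #{u ∈ U | f u ∈ A} = ∑ c ∈ A, #{u ∈ U | f u = c} := by
  rw [card_eq_sum_card_fiberwise (s := {u ∈ U | f u ∈ A}) (f := f) (t := A)
    fun u hu => (mem_filter.1 hu).2]
  refine sum_congr rfl fun c hc => ?_
  rw [filter_filter]
  congr 1
  ext u
  simp only [mem_filter]
  constructor
  · rintro ⟨h1, -, h2⟩; exact ⟨h1, h2⟩
  · rintro ⟨h1, rfl⟩; exact ⟨h1, hc, rfl⟩

/-- The inequalities satisfied by a set of colors that blocks an extension: `a` and `b` are the
numbers of blocking and of other colors, `z` counts the movable vertices with other colors, and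
`y` and `y'` count the vertices of `H` and `K` with other colors. -/
theorem blocked_bounds (hG : Degenerate G d) (hdeg : ∀ X v, degIn G X v + d + 1 ≤ 2 * k)
    {W K H U : Finset V} (hKH : K ⊆ H) (hHU : H ⊆ U) (hUW : U ⊆ W) (hW : #W = k * t) {T : ℚ}
    (hT : ∀ w ∈ W \ K, (degIn G (W \ K) w : ℚ) ≤ T) (hT0 : 0 ≤ T) (hTk : T ≤ 2 * k - d - 1)
    (hK : ∀ Y ⊆ K, 2 * T * #Y + arcs G (W \ Y) ≤ arcs G W) (hHK : 10 * #(H \ K) ≤ #K)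
    {v : V} (hv : degIn G U v + 2 * d < k) {f : V → Fin k}
    (hspread : ∀ c, #{u ∈ H | f u = c} ≤ h) (hcap : ∀ c, #{u ∈ U | f u = c} ≤ t)
    {A : Finset (Fin k)} (hA : ∃ c ∈ A, #{u ∈ U | f u = c} < t)
    (hAc : ∀ c ∉ A, #{u ∈ U | f u = c} = t)
    (hvA : ∀ c ∈ A, ∃ u ∈ U, f u = c ∧ G.Adj v u)
    (hAU : ∀ y ∈ U \ H, f y ∉ A → ∀ c ∈ A, ∃ u ∈ U, f u = c ∧ G.Adj y u) :
    ∃ a b z y y' : ℕ, a + b = k ∧ 2 * d < b ∧ b * t ≤ z + y ∧ y ≤ b * h ∧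
      a * z ≤ d * (a * t + z) ∧ (z : ℚ) ≤ h * (2 * k - d - 1) + (t - 1 - h) * T ∧
      T * y' + a * z ≤ d * k * t ∧ 10 * y ≤ 11 * y' + a * h := by
  set X := {u ∈ U | f u ∈ A} with hX
  set Z := {u ∈ U \ H | f u ∉ A} with hZ
  have hXZ : Disjoint X Z := by
    rw [disjoint_left]
    intro u hu hu'
    exact (mem_filter.1 hu').2 (mem_filter.1 hu).2
  have hXU : X ⊆ U := filter_subset _ _
  have hZU : Z ⊆ U := (filter_subset _ _).trans sdiff_subset
  have hcross : #A * #Z ≤ ∑ z ∈ Z, degIn G X z := by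
    rw [mul_comm, ← smul_eq_mul]
    exact card_nsmul_le_sum _ _ _ fun z hz =>
      card_le_degIn_of_forall_color (hAU z (mem_filter.1 hz).1 (mem_filter.1 hz).2)
  have hXcard : #X ≤ #A * t := by
    rw [hX, card_filter_mem_color, ← smul_eq_mul]
    exact sum_le_card_nsmul _ _ _ fun c _ => hcap c
  have hy : ∀ S : Finset V, #{u ∈ S | f u ∉ A} = #{u ∈ S | f u ∈ Aᶜ} := fun S => by simp
  refine ⟨#A, #Aᶜ, #Z, #{u ∈ H | f u ∉ A}, #{u ∈ K | f u ∉ A}, ?_, ?_, ?_, ?_, ?_, ?_, ?_, ?_⟩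
  · simp
  · have h1 := (card_le_degIn_of_forall_color hvA).trans (degIn_mono (filter_subset _ _) v)
    have h2 := card_add_card_compl A
    simp only [Fintype.card_fin] at h2
    omega
  · have h1 : #{u ∈ U | f u ∈ Aᶜ} = #Aᶜ * t := by
      rw [card_filter_mem_color, ← smul_eq_mul]
      exact sum_const_nat fun c hc => hAc c (mem_compl.1 hc)
    rw [← h1, ← hy, ← card_union_of_disjoint]
    · refine card_le_card fun u hu => ?_
      simp only [hZ, mem_union, mem_filter, mem_sdiff] at hu ⊢
      tauto
    · rw [disjoint_left]
      intro u hu hu'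
      exact (mem_sdiff.1 (mem_filter.1 hu).1).2 (mem_filter.1 hu').1
  · rw [hy, card_filter_mem_color, ← smul_eq_mul]
    exact sum_le_card_nsmul _ _ _ fun c _ => hspread c
  · have h1 := two_mul_cross_le (G := G) (subset_union_left (s₁ := X) (s₂ := Z))
      subset_union_right hXZ
    have h2 := hG.arcs_le (X ∪ Z)
    rw [card_union_of_disjoint hXZ] at h2
    nlinarith
  · obtain ⟨c, hcA, hc⟩ := hA
    set S := {u ∈ U | f u = c} with hS
    have h1 : #Z ≤ ∑ w ∈ S, degIn G Z w := by
      rw [sum_degIn_comm, card_eq_sum_ones]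
      refine sum_le_sum fun z hz => card_pos.2 ?_
      obtain ⟨u, hu, hfu, hadj⟩ := hAU z (mem_filter.1 hz).1 (mem_filter.1 hz).2 c hcA
      exact ⟨u, by simp [hS, hu, hfu, hadj]⟩
    have h2 : ∑ w ∈ S, (degIn G Z w : ℚ) ≤
        #{u ∈ H | f u = c} * (2 * k - d - 1) + #(S \ H) * T := by
      rw [← sum_inter_add_sum_sdiff S H]
      have h3 : S ∩ H = {u ∈ H | f u = c} := by
        ext u
        simp only [hS, mem_inter, mem_filter]
        constructor
        · rintro ⟨⟨_, h1⟩, h2⟩; exact ⟨h2, h1⟩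
        · rintro ⟨h1, h2⟩; exact ⟨⟨hHU h1, h2⟩, h1⟩
      rw [h3]
      refine add_le_add ?_ ?_
      · rw [← nsmul_eq_mul]
        refine sum_le_card_nsmul _ _ _ fun w _ => ?_
        have : ((degIn G Z w + d + 1 : ℕ) : ℚ) ≤ (2 * k : ℕ) := by exact_mod_cast hdeg Z w
        push_cast at this
        linarith
      · rw [← nsmul_eq_mul]
        refine sum_le_card_nsmul _ _ _ fun w hw => ?_
        rw [mem_sdiff] at hw
        refine le_trans ?_ (hT w (mem_sdiff.2 ⟨hUW (mem_filter.1 hw.1).1, fun h1 => hw.2 (hKH h1)⟩))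
        refine Nat.cast_le.2 (degIn_mono (fun z hz => ?_) w)
        have := mem_sdiff.1 (mem_filter.1 hz).1
        exact mem_sdiff.2 ⟨hUW this.1, fun h1 => this.2 (hKH h1)⟩
    have h3 : #(S \ H) + #{u ∈ H | f u = c} + 1 ≤ t := by
      have : #(S \ H) + #{u ∈ H | f u = c} = #S := by
        rw [← card_sdiff_add_card_inter S H]
        congr 2
        ext u
        simp only [hS, mem_inter, mem_filter]
        constructor
        · rintro ⟨h1, h2⟩; exact ⟨⟨hHU h1, h2⟩, h1⟩
        · rintro ⟨⟨_, h1⟩, h2⟩; exact ⟨h2, h1⟩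
      omega
    have h4 : ((#(S \ H) + #{u ∈ H | f u = c} + 1 : ℕ) : ℚ) ≤ t := by exact_mod_cast h3
    have h5 : (#{u ∈ H | f u = c} : ℚ) ≤ h := by exact_mod_cast hspread c
    have h6 : (#Z : ℚ) ≤ ∑ w ∈ S, (degIn G Z w : ℚ) := by exact_mod_cast h1
    push_cast at h4
    nlinarith [mul_nonneg (sub_nonneg.2 h5) (sub_nonneg.2 hTk),
      mul_nonneg (sub_nonneg.2 h4) hT0]
  · have hYK : {u ∈ K | f u ∉ A} ⊆ K := filter_subset _ _
    have h1 := hK _ hYK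
    have h2 : 2 * ∑ z ∈ Z, degIn G X z ≤ arcs G (W \ {u ∈ K | f u ∉ A}) := by
      refine two_mul_cross_le (fun u hu => ?_) (fun u hu => ?_) hXZ
      · exact mem_sdiff.2 ⟨hUW (hXU hu), fun h1 => (mem_filter.1 h1).2 (mem_filter.1 hu).2⟩
      · exact mem_sdiff.2 ⟨hUW (hZU hu), fun h1 =>
          (mem_sdiff.1 (mem_filter.1 hu).1).2 (hKH (mem_filter.1 h1).1)⟩
    have h3 := hG.arcs_le W
    rw [hW] at h3
    have h4 : ((2 * (#A * #Z) : ℕ) : ℚ) ≤ arcs G (W \ {u ∈ K | f u ∉ A}) := by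
      exact_mod_cast (Nat.mul_le_mul_left 2 hcross).trans h2
    have h5 : (arcs G W : ℚ) ≤ (2 * d * (k * t) : ℕ) := by exact_mod_cast h3
    push_cast at h4 h5
    linarith
  · have h1 : #K = #{u ∈ K | f u ∈ A} + #{u ∈ K | f u ∉ A} :=
      (card_filter_add_card_filter_not _).symm
    have h2 : #{u ∈ K | f u ∈ A} ≤ #A * h := by
      rw [card_filter_mem_color, ← smul_eq_mul]
      exact sum_le_card_nsmul _ _ _ fun c _ =>
        (card_le_card (filter_subset_filter _ hKH)).trans (hspread c)
    have h3 : #{u ∈ H | f u ∉ A} ≤ #{u ∈ K | f u ∉ A} + #(H \ K) := by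
      refine (card_le_card fun u hu => ?_).trans (card_union_le _ _)
      simp only [mem_union, mem_filter, mem_sdiff] at hu ⊢
      tauto
    omega

/-- Few colors can block an extension. -/
theorem five_mul_le_of_blocked {a b z y : ℕ} (hd : 0 < d) (hk : 14 * d ≤ k) (hth : 3 * h ≤ t)
    (ht : 0 < t) (hab : a + b = k) (hb : 2 * d < b) (hz : b * t ≤ z + y) (hy : y ≤ b * h)
    (hcross : a * z ≤ d * (a * t + z)) : 5 * a ≤ 6 * d := by
  by_contra! hcon
  have hz' : 2 * (b * t) ≤ 3 * z := by nlinarith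
  obtain ⟨e, rfl⟩ : ∃ e, a = d + e := ⟨a - d, by omega⟩
  have h1 : e * z ≤ d * (d + e) * t := by nlinarith
  have h2 : 2 * (e * b) ≤ 3 * (d * (d + e)) := by
    have : 2 * (e * b) * t ≤ 3 * (d * (d + e)) * t := by nlinarith
    exact Nat.le_of_mul_le_mul_right this ht
  have h3 : e ≤ 3 * d := by
    by_contra! h3
    nlinarith
  have h4 : 10 * d ≤ b := by omega
  nlinarith

theorem not_blocked_three {a b z y y' : ℕ} (hd : 0 < d) (hk : 14 * d ≤ k)
    (hab : a + b = k) (hb : 2 * d < b) (hz : b * 3 ≤ z + y) (hy : y ≤ b * 1)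
    (hcross : a * z ≤ d * (a * 3 + z))
    (hS : (z : ℚ) ≤ (1 : ℕ) * (2 * k - d - 1) + ((3 : ℕ) - 1 - (1 : ℕ)) * (6 * d))
    (hE : (6 * d : ℚ) * y' + a * z ≤ d * k * (3 : ℕ)) (hyy : 10 * y ≤ 11 * y' + a * 1) : False := by
  have ha : 5 * a ≤ 6 * d := five_mul_le_of_blocked hd hk le_rfl (by omega) hab hb hz hy hcross
  push_cast at hS hE
  have hS' : z + d + 1 ≤ 2 * k + 6 * d := by
    have : (z : ℚ) + d + 1 ≤ 2 * k + 6 * d := by linarith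
    exact_mod_cast this
  have hE' : 6 * d * y' + a * z ≤ d * k * 3 := by exact_mod_cast hE
  have h1 : k + 1 ≤ y + 3 * a + 5 * d := by omega
  have h2 : 24 * d ≤ z := by omega
  have h3 : 10 * k ≤ 11 * y' + 31 * a + 50 * d := by omega
  have h4 : 6 * d * (10 * k) ≤ 6 * d * (11 * y' + 31 * a + 50 * d) := Nat.mul_le_mul_left _ h3
  have h5 : a * (24 * d) ≤ a * z := Nat.mul_le_mul_left _ h2
  have h6 : d * (14 * d) ≤ d * k := Nat.mul_le_mul_left _ hk
  nlinarith

theorem not_blocked_of_four_le {a b z y : ℕ} (hd : 0 < d) (hk : 14 * d ≤ k)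
    (ht : 4 ≤ t) (hth : t ≤ 8 * h) (hht : 8 * h ≤ t + 7)
    (hab : a + b = k) (hb : 2 * d < b) (hz : b * t ≤ z + y) (hy : y ≤ b * h)
    (hcross : a * z ≤ d * (a * t + z))
    (hS : (z : ℚ) ≤ h * (2 * k - d - 1) + (t - 1 - h) * (11 * d * t / (10 * h))) : False := by
  have ha : 5 * a ≤ 6 * d :=
    five_mul_le_of_blocked hd hk (by omega) (by omega) hab hb hz hy hcross
  have hh : 0 < h := by omega
  have hpoly : (398 * h ^ 2 + 11 * t ^ 2 : ℚ) ≤ 139 * h * t + 11 * t := by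
    by_cases h4 : t = 4
    · obtain rfl : h = 1 := by omega
      subst h4; norm_num
    · have h1 : 9 * h ≤ 2 * t := by omega
      have h1' : (9 * h : ℚ) ≤ 2 * t := by exact_mod_cast h1
      have h2' : (t : ℚ) ≤ 8 * h := by exact_mod_cast hth
      have h3' : (0 : ℚ) < h := by exact_mod_cast hh
      nlinarith [mul_nonneg (sub_nonneg.2 h1') (sub_nonneg.2 h2')]
  have hth3 : (3 * h : ℚ) ≤ t := by exact_mod_cast (by omega : 3 * h ≤ t)
  have hzz : (b : ℚ) * (t - h) ≤ z := by
    have : b * t ≤ z + b * h := by omega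
    have : (b * t : ℚ) ≤ z + b * h := by exact_mod_cast this
    linarith
  have hbq : (k : ℚ) - 6 / 5 * d ≤ b := by
    have h1 : (5 * a : ℚ) ≤ 6 * d := by exact_mod_cast ha
    have h2 : (a + b : ℚ) = k := by exact_mod_cast hab
    linarith
  have hkq : (14 * d : ℚ) ≤ k := by exact_mod_cast hk
  have hhq : (0 : ℚ) < h := by exact_mod_cast hh
  have hdq : (0 : ℚ) < d := by exact_mod_cast hd
  have h1 : ((k : ℚ) - 6 / 5 * d) * (t - h) ≤ z :=
    (mul_le_mul_of_nonneg_right hbq (by linarith)).trans hzz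
  have h2 : (14 * d : ℚ) * (t - 3 * h) ≤ k * (t - 3 * h) :=
    mul_le_mul_of_nonneg_right hkq (by linarith)
  have h3 : (14 * d : ℚ) * (t - 3 * h) + h * (d + 1) - 6 / 5 * d * (t - h) ≤
      (t - 1 - h) * (11 * d * t / (10 * h)) := by linarith
  have h4 : (t - 1 - h) * (11 * d * t / (10 * h) : ℚ) * (10 * h) = (t - 1 - h) * (11 * d * t) := by
    field_simp
  have h5 := mul_le_mul_of_nonneg_right h3 (by positivity : (0 : ℚ) ≤ 10 * h)
  rw [h4] at h5
  have h6 := mul_le_mul_of_nonneg_left hpoly hdq.le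
  nlinarith [mul_pos hhq hhq]

/-- Coloring a larger set with caps `t`, starting from a coloring of the set obtained by
collecting the vertices of large degree. -/
theorem exists_capped_of_not_blocked (hG : Degenerate G d)
    (hdeg : ∀ X v, degIn G X v + d + 1 ≤ 2 * k) (hd : 0 < d) (hk : 14 * d ≤ k) (ht : 0 < t)
    (hht : h ≤ t)
    (hcol : ∀ W : Finset V, #W = k * h →
      ∃ f : V → Fin k, ProperOn G W f ∧ ∀ c, #{u ∈ W | f u = c} ≤ h)
    {T : ℚ} (hT0 : 0 ≤ T) (hTk : T ≤ 2 * k - d - 1) (hTt : (11 * d * t : ℚ) ≤ 10 * h * T)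
    (hblock : ∀ a b z y y' : ℕ, a + b = k → 2 * d < b → b * t ≤ z + y → y ≤ b * h →
      a * z ≤ d * (a * t + z) → (z : ℚ) ≤ h * (2 * k - d - 1) + (t - 1 - h) * T →
      T * y' + a * z ≤ d * k * t → 10 * y ≤ 11 * y' + a * h → False)
    {W : Finset V} (hW : #W = k * t) :
    ∃ f : V → Fin k, ProperOn G W f ∧ ∀ c, #{u ∈ W | f u = c} ≤ t := by
  obtain ⟨K, hKW, hKT, hK⟩ := exists_heavy G W T
  obtain ⟨H, hHW, hKH, hHK, hpeel⟩ := hG.exists_peeling_base hKW (k - 2 * d)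
  have hHK' : 10 * #(H \ K) ≤ #K := by
    have h1 : 12 * d * #(H \ K) ≤ (k - 2 * d) * #(H \ K) := Nat.mul_le_mul_right _ (by omega)
    have h2 : d * (10 * #(H \ K)) ≤ d * #K := by nlinarith
    exact Nat.le_of_mul_le_mul_left h2 hd
  have hKcard : 11 * #K ≤ 10 * (k * h) := by
    have h1 := hK K Subset.rfl
    have h2 : (arcs G W : ℚ) ≤ (2 * d * (k * t) : ℕ) := by
      rw [← hW]; exact_mod_cast hG.arcs_le W
    push_cast at h2
    have h3 : (0 : ℚ) ≤ arcs G (W \ K) := by positivity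
    have h4 : T * #K ≤ d * k * t := by linarith
    have h5 : (11 * d * t : ℚ) * #K ≤ 10 * h * T * #K :=
      mul_le_mul_of_nonneg_right hTt (by positivity)
    have h6 : (10 * h : ℚ) * (T * #K) ≤ 10 * h * (d * k * t) :=
      mul_le_mul_of_nonneg_left h4 (by positivity)
    have h7 : (d * t : ℚ) * (11 * #K) ≤ d * t * (10 * (k * h)) := by linarith
    have h8 : (d * t) * (11 * #K) ≤ d * t * (10 * (k * h)) := by exact_mod_cast h7
    exact Nat.le_of_mul_le_mul_left h8 (Nat.mul_pos hd ht)
  have hHcard : #H ≤ k * h := by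
    have := card_sdiff_add_card_eq_card hKH
    omega
  obtain ⟨H', hHH', hH'W, hH'⟩ := exists_subsuperset_card_eq hHW hHcard
    (by rw [hW]; exact Nat.mul_le_mul_left _ hht)
  obtain ⟨f₀, hf₀, hf₀h⟩ := hcol H' hH'
  suffices hext : ∀ n, ∀ U : Finset V, #(U \ H) = n → H ⊆ U → U ⊆ W → ∃ f : V → Fin k,
      ProperOn G U f ∧ (∀ c, #{u ∈ U | f u = c} ≤ t) ∧ ∀ c, #{u ∈ H | f u = c} ≤ h by
    obtain ⟨f, h1, h2, -⟩ := hext _ W rfl hHW Subset.rfl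
    exact ⟨f, h1, h2⟩
  intro n
  induction n with
  | zero =>
    intro U hU hHU _
    obtain rfl : H = U := hHU.antisymm (sdiff_eq_empty_iff_subset.1 (card_eq_zero.1 hU))
    have h1 : ∀ c, #{u ∈ H | f₀ u = c} ≤ h := fun c =>
      (card_le_card (filter_subset_filter _ hHH')).trans (hf₀h c)
    exact ⟨f₀, fun u hu v hv => hf₀ u (hHH' hu) v (hHH' hv), fun c => (h1 c).trans hht, h1⟩
  | succ n ih =>
    intro U hU hHU hUW
    have hss : H ⊂ U := by
      refine hHU.ssubset_of_ne ?_
      rintro rfl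
      simp at hU
    obtain ⟨v, hv, hvd⟩ := hpeel U hss hUW
    have hvU := (mem_sdiff.1 hv).1
    have hvH := (mem_sdiff.1 hv).2
    have hHU' : H ⊆ U.erase v := subset_erase.2 ⟨hHU, hvH⟩
    have hU'W : U.erase v ⊆ W := (erase_subset _ _).trans hUW
    obtain ⟨f, hf, hcap, hspread⟩ := ih (U.erase v)
      (by rw [erase_sdiff_comm, card_erase_of_mem hv]; omega) hHU' hU'W
    have hlt : #(U.erase v) < k * t :=
      hW ▸ (card_erase_lt_of_mem hvU).trans_le (card_le_card hUW)
    rcases extend_or_blocked (notMem_erase v U) hHU' hf hcap hlt with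
      ⟨f', h1, h2, h3⟩ | ⟨A, h1, h2, h3, h4⟩
    · rw [insert_erase hvU] at h1 h2
      refine ⟨f', h1, h2, fun c => ?_⟩
      rw [filter_congr fun x hx => by rw [h3 x hx]]
      exact hspread c
    · have hvd' : degIn G (U.erase v) v + 2 * d < k := by
        have := degIn_mono (G := G) (erase_subset v U) v
        omega
      obtain ⟨a, b, z, y, y', hab, hb, hz, hy, hcross, hS, hE, hyy⟩ := blocked_bounds hG hdeg hKH
        hHU' hU'W hW hKT hT0 hTk hK hHK' hvd' hspread hcap h1 h2 h3 h4
      exact (hblock a b z y y' hab hb hz hy hcross hS hE hyy).elim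

theorem false_of_many_parts {W ι : Type*} [Fintype W] [DecidableEq ι] {G : SimpleGraph W}
    (hG : Degenerate G d) (hdeg : ∀ X v, degIn G X v + d + 1 ≤ 2 * k)
    (hW : Fintype.card W = 2 * k) {A : Finset W} {part : W → ι}
    (hadj : ∀ x ∈ A, ∀ y ∈ A, part x ≠ part y → G.Adj x y)
    (hparts : #Aᶜ + 2 ≤ #(A.image part)) : False := by
  have hA : A.Nonempty := by
    rw [← image_nonempty (f := part), ← card_pos]; omega
  obtain ⟨v, hv, hvd⟩ := hG A hA
  set R := {x ∈ A | part x ≠ part v} with hR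
  have hRd : #R ≤ d := by
    refine (card_le_card fun x hx => ?_).trans hvd
    rw [mem_filter] at hx ⊢
    exact ⟨hx.1, hadj v hv x hx.1 hx.2.symm⟩
  have hRA : (A.image part).erase (part v) ⊆ R.image part := by
    intro c hc
    rw [mem_erase, mem_image] at hc
    obtain ⟨hcv, x, hx, rfl⟩ := hc
    exact mem_image_of_mem _ (mem_filter.2 ⟨hx, hcv⟩)
  have hR1 : #Aᶜ + 1 ≤ #(R.image part) := by
    have h1 := card_le_card hRA
    rw [card_erase_of_mem (mem_image_of_mem _ hv)] at h1
    omega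
  obtain ⟨x, hx⟩ : R.Nonempty := by
    rw [← image_nonempty (f := part), ← card_pos]; omega
  have hxA := (mem_filter.1 hx).1
  set D := {y ∈ A | part y = part x} with hD
  have hDR : D ⊆ R := by
    intro y hy
    rw [mem_filter] at hy hx ⊢
    exact ⟨hy.1, hy.2 ▸ hx.2⟩
  have hRD : #Aᶜ ≤ #(R \ D) := by
    have h1 : (R.image part).erase (part x) ⊆ (R \ D).image part := by
      intro c hc
      rw [mem_erase, mem_image] at hc
      obtain ⟨hcx, y, hy, rfl⟩ := hc
      exact mem_image_of_mem _ (mem_sdiff.2 ⟨hy, fun h1 => hcx (mem_filter.1 h1).2⟩)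
    have h2 := (card_le_card h1).trans card_image_le
    rw [card_erase_of_mem (mem_image_of_mem _ hx)] at h2
    omega
  have h1 : #(A \ D) ≤ degIn G A x := by
    refine card_le_card fun y hy => ?_
    rw [mem_sdiff, mem_filter] at hy
    exact mem_filter.2 ⟨hy.1, hadj x hxA y hy.1 fun h2 => hy.2 ⟨hy.1, h2.symm⟩⟩
  have h2 := hdeg A x
  have h3 := card_sdiff_add_card_eq_card (show D ⊆ A from filter_subset _ _)
  have h4 := card_sdiff_add_card_eq_card hDR
  have h5 := card_add_card_compl A
  omega

theorem exists_isPerfectMatching_compl {W : Type*} [Fintype W] {G : SimpleGraph W}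
    (hG : Degenerate G d) (hdeg : ∀ X v, degIn G X v + d + 1 ≤ 2 * k)
    (hW : Fintype.card W = 2 * k) : ∃ M : Gᶜ.Subgraph, M.IsPerfectMatching := by
  rw [SimpleGraph.tutte]
  intro u hu
  set Q := ((⊤ : Gᶜ.Subgraph).deleteVerts u) with hQ
  have hverts : ∀ x, x ∈ Q.verts ↔ x ∉ u := fun x => by simp [hQ]
  let part : W → Option Q.coe.ConnectedComponent := fun x =>
    if hx : x ∈ Q.verts then some (Q.coe.connectedComponentMk ⟨x, hx⟩) else none
  have hcompl : #({x | x ∈ Q.verts} : Finset W)ᶜ = u.ncard := by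
    rw [Set.ncard_eq_toFinset_card']
    congr 1
    ext x
    simp [hverts]
  have hcard : Nat.card Q.verts = #({x | x ∈ Q.verts} : Finset W) := by
    rw [Nat.card_eq_fintype_card, Fintype.card_subtype]
  have hparity := SimpleGraph.odd_ncard_oddComponents Q.coe
  unfold SimpleGraph.IsTutteViolator at hu
  rw [← hQ] at hu
  have hmany : u.ncard + 2 ≤ Q.coe.oddComponents.ncard := by
    have h1 := card_add_card_compl ({x | x ∈ Q.verts} : Finset W)
    rw [hcompl, ← hcard, hW] at h1
    rcases Nat.lt_or_ge (u.ncard + 1) Q.coe.oddComponents.ncard with h2 | h2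
    · exact h2
    · have h3 : Q.coe.oddComponents.ncard = u.ncard + 1 := by omega
      rw [h3] at hparity
      simp only [Nat.odd_iff] at hparity
      omega
  refine false_of_many_parts hG hdeg hW (A := {x | x ∈ Q.verts}) (part := part) ?_ ?_
  · intro x hx y hy hxy
    simp only [mem_filter, mem_univ, true_and] at hx hy
    simp only [part, hx, hy, dif_pos] at hxy
    by_contra hnadj
    refine hxy ?_
    have hne : x ≠ y := by rintro rfl; exact hxy rfl
    congr 1
    refine SimpleGraph.ConnectedComponent.sound (SimpleGraph.Adj.reachable ?_)
    have : Gᶜ.Adj x y := by simp [hne, hnadj]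
    simp only [SimpleGraph.Subgraph.coe_adj, hQ, SimpleGraph.Subgraph.deleteVerts_adj]
    simp [this, (hverts x).1 hx, (hverts y).1 hy]
  · rw [hcompl]
    refine hmany.trans ((Set.ncard_le_card _).trans ?_)
    rw [Nat.card_eq_fintype_card, ← card_univ, ← card_map Function.Embedding.some]
    refine card_le_card fun c hc => ?_
    simp only [mem_map, mem_univ, true_and, Function.Embedding.some_apply] at hc
    obtain ⟨c, rfl⟩ := hc
    induction c using SimpleGraph.ConnectedComponent.ind with
    | h x => exact mem_image.2 ⟨x, by simp, by simp [part]⟩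

theorem exists_pairs_coloring {W : Type*} [Fintype W] {G : SimpleGraph W}
    (hG : Degenerate G d) (hdeg : ∀ X v, degIn G X v + d + 1 ≤ 2 * k)
    (hW : Fintype.card W = 2 * k) :
    ∃ f : W → Fin k, (∀ u v, G.Adj u v → f u ≠ f v) ∧ ∀ c, #{u | f u = c} ≤ 2 := by
  obtain ⟨M, hM⟩ := exists_isPerfectMatching_compl hG hdeg hW
  rw [SimpleGraph.Subgraph.isPerfectMatching_iff] at hM
  choose p hp hp' using hM
  have hpp : ∀ v, p (p v) = v := fun v => (hp' (p v) v (hp v).symm).symm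
  let g : W → Sym2 W := fun v => s(v, p v)
  have hg : ∀ u v, g u = g v ↔ u = v ∨ u = p v := by
    intro u v
    simp only [g, Sym2.eq_iff]
    constructor
    · tauto
    · rintro (rfl | rfl)
      · simp
      · simp [hpp]
  have hfib : ∀ v, #{u | g u = g v} = 2 := by
    intro v
    have h1 : ({u | g u = g v} : Finset W) = {v, p v} := by ext u; simp [hg]
    rw [h1, card_pair (hp v).ne]
  have himg : #(univ.image g) = k := by
    have h1 := card_eq_sum_card_image g (univ : Finset W)
    rw [sum_const_nat (m := 2) (fun c hc => ?_), card_univ, hW] at h1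
    · omega
    · obtain ⟨v, -, rfl⟩ := mem_image.1 hc
      exact hfib v
  let e := (univ.image g).equivFinOfCardEq himg
  have he : ∀ u v, e ⟨g u, mem_image_of_mem _ (mem_univ _)⟩ =
      e ⟨g v, mem_image_of_mem _ (mem_univ _)⟩ ↔ g u = g v := by
    intro u v; simp
  refine ⟨fun v => e ⟨g v, mem_image_of_mem _ (mem_univ _)⟩, fun u v huv hne => ?_, fun c => ?_⟩
  · rw [he, hg] at hne
    rcases hne with rfl | rfl
    · exact huv.ne rfl
    · have := (hp v).adj_sub
      rw [SimpleGraph.compl_adj] at this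
      exact this.2 huv.symm
  · rcases (univ.filter fun u => e ⟨g u, mem_image_of_mem _ (mem_univ _)⟩ = c).eq_empty_or_nonempty
      with h1 | ⟨v, hv⟩
    · rw [h1]; simp
    · simp only [mem_filter, mem_univ, true_and] at hv
      subst hv
      simp only [he, hfib, le_refl]

theorem degIn_comap {U : Type*} (φ : U ↪ V) (X : Finset U) (v : U) :
    degIn (G.comap φ) X v = degIn G (X.map φ) (φ v) := by
  unfold degIn
  rw [filter_map, card_map]
  rfl

theorem Degenerate.comap {U : Type*} (hG : Degenerate G d) (φ : U ↪ V) :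
    Degenerate (G.comap φ) d := by
  intro A hA
  obtain ⟨v, hv, hvd⟩ := hG (A.map φ) (hA.map)
  obtain ⟨u, hu, rfl⟩ := mem_map.1 hv
  exact ⟨u, hu, by rwa [degIn_comap]⟩

/-- Every set of `k * t` vertices has a proper `k`-coloring with all classes of size at most
`t`. -/
theorem exists_capped (hG : Degenerate G d) (hdeg : ∀ X v, degIn G X v + d + 1 ≤ 2 * k)
    (hd : 0 < d) (hk : 14 * d ≤ k) (t : ℕ) (W : Finset V) (hW : #W = k * t) :
    ∃ f : V → Fin k, ProperOn G W f ∧ ∀ c, #{u ∈ W | f u = c} ≤ t := by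
  have : NeZero k := ⟨by omega⟩
  induction t using Nat.strong_induction_on generalizing W with
  | _ t ih =>
  have hkq : (14 * d : ℚ) ≤ k := by exact_mod_cast hk
  have hdq : (1 : ℚ) ≤ d := by exact_mod_cast hd
  rcases (by omega : t = 0 ∨ t = 1 ∨ t = 2 ∨ t = 3 ∨ 4 ≤ t) with rfl | rfl | rfl | rfl | ht
  · rw [mul_zero, card_eq_zero] at hW
    subst hW
    exact ⟨fun _ => 0, by simp [ProperOn], by simp⟩
  · let e := W.equivFinOfCardEq (hW.trans (mul_one k))
    let f : V → Fin k := fun v => if hv : v ∈ W then e ⟨v, hv⟩ else 0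
    have hf : ∀ u ∈ W, ∀ v ∈ W, f u = f v → u = v := by
      intro u hu v hv huv
      simpa [f, hu, hv] using huv
    refine ⟨f, fun u hu v hv huv hfuv => huv.ne (hf u hu v hv hfuv), fun c => ?_⟩
    refine card_le_one.2 fun u hu v hv => ?_
    rw [mem_filter] at hu hv
    exact hf u hu.1 v hv.1 (hu.2.trans hv.2.symm)
  · obtain ⟨g, hg, hgc⟩ := exists_pairs_coloring
      (hG.comap (Function.Embedding.subtype (· ∈ W))) (k := k)
      (fun X v => by rw [degIn_comap]; exact hdeg _ _) (by rw [Fintype.card_coe, hW, mul_comm])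
    refine ⟨fun v => if hv : v ∈ W then g ⟨v, hv⟩ else 0, fun u hu v hv huv => ?_, fun c => ?_⟩
    · simpa only [hu, hv, dif_pos] using hg ⟨u, hu⟩ ⟨v, hv⟩ huv
    · refine (card_le_card (t := ({u | g u = c} : Finset W).map
        (Function.Embedding.subtype (· ∈ W))) fun v hv => ?_).trans
        ((card_map _).trans_le (hgc c))
      obtain ⟨hvW, hvc⟩ := mem_filter.1 hv
      simp only [hvW, dif_pos] at hvc
      exact mem_map.2 ⟨⟨v, hvW⟩, by simpa using hvc, rfl⟩
  · refine exists_capped_of_not_blocked (h := 1) (T := 6 * d) hG hdeg hd hk (by omega) (by omega)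
      (fun W hW => ih 1 (by omega) W hW) (by positivity) (by linarith) (by push_cast; linarith)
      (fun a b z y y' hab hb hz hy hcross hS hE hyy =>
        not_blocked_three hd hk hab hb hz hy hcross hS hE hyy) hW
  · obtain ⟨h, hth, hht⟩ : ∃ h, t ≤ 8 * h ∧ 8 * h ≤ t + 7 := ⟨(t + 7) / 8, by omega, by omega⟩
    have hh : (0 : ℚ) < h := by exact_mod_cast (by omega : 0 < h)
    have hthq : (t : ℚ) ≤ 8 * h := by exact_mod_cast hth
    refine exists_capped_of_not_blocked (h := h) (T := 11 * d * t / (10 * h)) hG hdeg hd hk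
      (by omega) (by omega) (fun W hW => ih h (by omega) W hW) (by positivity) ?_ ?_
      (fun a b z y y' hab hb hz hy hcross hS _ _ =>
        not_blocked_of_four_le hd hk ht hth hht hab hb hz hy hcross hS) hW
    · rw [div_le_iff₀ (by positivity)]
      have h1 : (d : ℚ) * t ≤ d * (8 * h) := mul_le_mul_of_nonneg_left hthq (by positivity)
      have h2 : (h : ℚ) * (14 * d) ≤ h * k := mul_le_mul_of_nonneg_left hkq hh.le
      have h3 : (h : ℚ) * 1 ≤ h * d := mul_le_mul_of_nonneg_left hdq hh.le
      have h4 : (0 : ℚ) ≤ h * d := by positivity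
      nlinarith
    · exact (mul_div_cancel₀ _ (by positivity)).ge

theorem sum_card_color (W : Finset V) (f : V → Fin k) : ∑ c, #{u ∈ W | f u = c} = #W :=
  (card_eq_sum_card_fiberwise fun _ _ => mem_univ _).symm

theorem card_color_eq {W : Finset V} (hW : #W = k * t) {f : V → Fin k}
    (hf : ∀ c, #{u ∈ W | f u = c} ≤ t) (c : Fin k) : #{u ∈ W | f u = c} = t := by
  have h1 : ∑ c, #{u ∈ W | f u = c} = ∑ _c : Fin k, t := by
    rw [sum_card_color, hW]; simp
  exact (sum_eq_sum_iff_of_le fun c _ => hf c).1 h1 c (mem_univ c)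

/-- Adding vertices one by one to a set with a perfectly balanced coloring. -/
theorem exists_balanced_of_add_le (hG : Degenerate G d) {q : ℕ}
    (hcol : ∀ W : Finset V, #W = k * q →
      ∃ f : V → Fin k, ProperOn G W f ∧ ∀ c, #{u ∈ W | f u = c} ≤ q)
    (r : ℕ) (hr : r + d ≤ k) (W : Finset V) (hW : #W = k * q + r) :
    ∃ f : V → Fin k, ProperOn G W f ∧ ∀ c, q ≤ #{u ∈ W | f u = c} ∧ #{u ∈ W | f u = c} ≤ q + 1 := by
  induction r generalizing W with
  | zero =>
    obtain ⟨f, hf, hfc⟩ := hcol W hW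
    refine ⟨f, hf, fun c => ?_⟩
    have := card_color_eq hW hfc c
    omega
  | succ r ih =>
    obtain ⟨v, hv, hvd⟩ := hG W (card_pos.1 (by omega))
    set U := W.erase v with hU
    have hUW : insert v U = W := insert_erase hv
    have hvU : v ∉ U := notMem_erase v W
    have hUcard : #U = k * q + r := by rw [hU, card_erase_of_mem hv]; omega
    obtain ⟨f, hf, hfc⟩ := ih (by omega) U hUcard
    set B := {u ∈ W | G.Adj v u}.image f
    set C := ({c | #{u ∈ U | f u = c} = q + 1} : Finset (Fin k)) with hC
    have hB : #B ≤ d := card_image_le.trans hvd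
    have hCr : #C ≤ r := by
      have h1 : ∑ c, (q + if c ∈ C then 1 else 0) ≤ ∑ c, #{u ∈ U | f u = c} := by
        refine sum_le_sum fun c _ => ?_
        split_ifs with hc
        · exact (mem_filter.1 hc).2.ge
        · exact (hfc c).1
      rw [sum_card_color, sum_add_distrib, hUcard] at h1
      simpa using h1
    obtain ⟨c, hc⟩ : ∃ c, c ∉ B ∪ C := by
      by_contra! hall
      have h1 : #(univ : Finset (Fin k)) ≤ #(B ∪ C) := card_le_card fun c _ => hall c
      have h2 := card_union_le B C
      rw [card_univ, Fintype.card_fin] at h1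
      omega
    rw [mem_union, not_or] at hc
    refine ⟨Function.update f v c, ?_, fun c' => ?_⟩
    · rw [← hUW]
      refine hf.update_insert fun u hu huc huv => hc.1 ?_
      exact mem_image.2 ⟨u, mem_filter.2 ⟨mem_of_mem_erase hu, huv⟩, huc⟩
    · have hfilter : #{u ∈ U | Function.update f v c u = c'} = #{u ∈ U | f u = c'} := by
        congr 1
        refine filter_congr fun u hu => ?_
        rw [Function.update_of_ne (ne_of_mem_of_not_mem hu hvU)]
      rw [← hUW, filter_insert, Function.update_self]
      have h1 := hfc c'
      split_ifs with hcc
      · subst hcc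
        rw [card_insert_of_notMem (by simp [hvU]), hfilter]
        have h2 : #{u ∈ U | f u = c} ≠ q + 1 := fun h2 => hc.2 (mem_filter.2 ⟨mem_univ _, h2⟩)
        omega
      · rwa [hfilter]

theorem degIn_sum_inl {U : Type*} (G' : SimpleGraph U) (A : Finset (V ⊕ U)) (v : V) :
    degIn (G ⊕g G') A (Sum.inl v) ≤ degIn G A.toLeft v := by
  unfold degIn
  refine (card_le_card (t := {u ∈ A.toLeft | G.Adj v u}.map .inl) fun x hx => ?_).trans_eq
    (card_map _)
  rw [mem_filter] at hx
  rcases x with x | x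
  · exact mem_map_of_mem _ (mem_filter.2 ⟨mem_toLeft.2 hx.1, by simpa using hx.2⟩)
  · simp at hx

theorem degIn_sum_inr {U : Type*} [Fintype U] (G' : SimpleGraph U) (A : Finset (V ⊕ U)) (i : U) :
    degIn (G ⊕g G') A (Sum.inr i) ≤ Fintype.card U := by
  unfold degIn
  refine (card_le_card (t := (univ : Finset U).map .inr) fun x hx => ?_).trans_eq
    ((card_map _).trans card_univ)
  rw [mem_filter] at hx
  rcases x with x | x
  · simp at hx
  · exact mem_map_of_mem _ (mem_univ x)

theorem Degenerate.sum {U : Type*} [Fintype U] (hG : Degenerate G d) (G' : SimpleGraph U)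
    (hU : Fintype.card U ≤ d) : Degenerate (G ⊕g G') d := by
  intro A hA
  rcases A.toLeft.eq_empty_or_nonempty with h1 | h1
  · obtain ⟨x | x, hx⟩ := hA
    · simpa [h1] using mem_toLeft.2 hx
    · exact ⟨_, hx, (degIn_sum_inr G' A x).trans hU⟩
  · obtain ⟨v, hv, hvd⟩ := hG _ h1
    exact ⟨_, mem_toLeft.1 hv, (degIn_sum_inl G' A v).trans hvd⟩

theorem exists_equitable [Fintype V] (hG : Degenerate G d)
    (hdeg : ∀ X v, degIn G X v + d + 1 ≤ 2 * k) (hd : 0 < d) (hk : 14 * d ≤ k) :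
    ∃ f : V → Fin k, (∀ u v, G.Adj u v → f u ≠ f v) ∧
      ∃ q, ∀ c, q ≤ #{u | f u = c} ∧ #{u | f u = c} ≤ q + 1 := by
  set q := Fintype.card V / k
  set r := Fintype.card V % k
  have hn : k * q + r = Fintype.card V := Nat.div_add_mod _ _
  have hrk : r < k := Nat.mod_lt _ (by omega)
  rcases Nat.lt_or_ge k (r + d) with hr | hr
  · have hp : Fintype.card (Fin (k - r)) ≤ d := by rw [Fintype.card_fin]; omega
    obtain ⟨f, hf, hfc⟩ := exists_capped (hG.sum (⊤ : SimpleGraph (Fin (k - r))) hp) (k := k)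
      (by
        rintro X (v | v)
        · have h1 := degIn_sum_inl (G := G) (⊤ : SimpleGraph (Fin (k - r))) X v
          have h2 := hdeg X.toLeft v
          omega
        · have h1 := degIn_sum_inr (G := G) (⊤ : SimpleGraph (Fin (k - r))) X v
          omega) hd hk (q + 1) univ (by
        rw [card_univ, Fintype.card_sum, Fintype.card_fin, mul_add]; omega)
    have hcard : #(univ : Finset (V ⊕ Fin (k - r))) = k * (q + 1) := by
      rw [card_univ, Fintype.card_sum, Fintype.card_fin, mul_add]; omega
    refine ⟨fun v => f (Sum.inl v), fun u v huv => hf _ (mem_univ _) _ (mem_univ _) (by simpa),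
      q, fun c => ?_⟩
    have h1 := card_color_eq hcard hfc c
    rw [card_filter, Fintype.sum_sum_type, ← card_filter, ← card_filter] at h1
    have h2 : #{i | f (Sum.inr i) = c} ≤ 1 := by
      refine card_le_one.2 fun i hi j hj => ?_
      rw [mem_filter] at hi hj
      by_contra hij
      exact hf (Sum.inr i) (mem_univ _) (Sum.inr j) (mem_univ _) (by simpa) (hi.2.trans hj.2.symm)
    beta_reduce
    omega
  · obtain ⟨f, hf, hfc⟩ := exists_balanced_of_add_le hG (exists_capped hG hdeg hd hk q) r hr univ
      (by rw [card_univ, hn])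
    exact ⟨f, fun u v => hf u (mem_univ u) v (mem_univ v), q, hfc⟩

end

end EquitableColoring

/-- **Kostochka–Nakprasit (2003).** Let `d ≥ 2`, `Δ ≥ 27d` and `k ≥ (d + Δ + 1)/2`. Then
every `d`-degenerate graph with maximum degree at most `Δ` has an equitable
`k`-coloring. (A graph is `d`-degenerate if every nonempty induced subgraph has a vertex
of degree at most `d` within it.) -/
theorem kostochka_nakprasit_degenerate {V : Type*} [Fintype V] (G : SimpleGraph V)
    [DecidableRel G.Adj] (d Δ k : ℕ) (hd : 2 ≤ d) (hΔd : 27 * d ≤ Δ)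
    (hk : ((d : ℚ) + (Δ : ℚ) + 1) / 2 ≤ (k : ℚ))
    (hdegen : ∀ A : Finset V, A.Nonempty →
      ∃ v ∈ A, (A.filter fun u => G.Adj v u).card ≤ d)
    (hmax : G.maxDegree ≤ Δ) :
    ∃ f : V → Fin k,
      (∀ ⦃u v : V⦄, G.Adj u v → f u ≠ f v) ∧
      (∀ c c' : Fin k,
        (Finset.univ.filter fun v => f v = c).card ≤
          (Finset.univ.filter fun v => f v = c').card + 1) := by
  have hk' : d + Δ + 1 ≤ 2 * k := by
    rw [div_le_iff₀ two_pos] at hk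
    have h1 : d + Δ + 1 ≤ k * 2 := by exact_mod_cast hk
    omega
  have hG : EquitableColoring.Degenerate G d := by
    intro A hA
    obtain ⟨v, hv, hvd⟩ := hdegen A hA
    refine ⟨v, hv, ?_⟩
    unfold EquitableColoring.degIn
    convert hvd
  have hdeg : ∀ X v, EquitableColoring.degIn G X v + d + 1 ≤ 2 * k := by
    intro X v
    have h1 : EquitableColoring.degIn G X v ≤ G.degree v := by
      refine Finset.card_le_card fun u hu => (G.mem_neighborFinset v u).2 ?_
      exact (@Finset.mem_filter _ _ (_) _ _ |>.1 hu).2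
    have h2 := G.degree_le_maxDegree v
    omega
  obtain ⟨f, hf, q, hq⟩ := EquitableColoring.exists_equitable hG hdeg (by omega) (by omega)
  refine ⟨f, fun u v => hf u v, fun c c' => ?_⟩
  have h1 := (hq c).2
  have h2 := (hq c').1
  refine le_trans (le_trans (le_of_eq ?_) h1) (Nat.add_le_add_right (le_trans h2 (le_of_eq ?_)) 1)
  · congr!
  · congr!
end
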